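/- arXiv:2412.12860 — 2 statements merged into one kernel-verified Lean document; each statement's English description precedes it below -/
import Mathlib

section
/- Let Δ be a d-dimensional connected simplicial complex. If 𝕜[Δ] is Gorenstein on the punctured spectrum, then at least one of the following holds: (a) d ≤ 1; (b) Δ has a cone point; (c) Δ is a 𝕜-homology manifold. -/
/-! # Preliminaries

Self-contained definitions: simplicial complexes, simplicial homology, Stanley–Reisner rings,
canonical modules, canonical traces, and the various Gorenstein-type conditions. -/

open CategoryTheory

/-- An abstract simplicial complex on the vertex set `Fin n` (the empty set is a face). -/
structure SC (n : ℕ) where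
  faces : Finset (Finset (Fin n))
  empty_mem : ∅ ∈ faces
  down_closed : ∀ {σ τ : Finset (Fin n)}, σ ∈ faces → τ ⊆ σ → τ ∈ faces

namespace SC

variable {n : ℕ} (Δ : SC n)

/-- The dimension of a simplicial complex, as an integer (the complex `{∅}` has
dimension `-1`). -/
def dim : ℤ := ((Δ.faces.sup Finset.card : ℕ) : ℤ) - 1

/-- `v` is a vertex of `Δ`. -/
def IsVertex (v : Fin n) : Prop := {v} ∈ Δ.faces

/-- A facet is a face which is maximal by inclusion. -/
def IsFacet (σ : Finset (Fin n)) : Prop :=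
  σ ∈ Δ.faces ∧ ∀ τ ∈ Δ.faces, σ ⊆ τ → σ = τ

/-- A cone point is a vertex contained in every facet. -/
def IsConePoint (v : Fin n) : Prop :=
  Δ.IsVertex v ∧ ∀ σ, Δ.IsFacet σ → v ∈ σ

/-- A simplicial complex is connected if it has a vertex and any two vertices are joined
by a path of edges. -/
def Connected : Prop :=
  (∃ v, Δ.IsVertex v) ∧ ∀ u v, Δ.IsVertex u → Δ.IsVertex v →
    Relation.ReflTransGen (fun a b => ({a, b} : Finset (Fin n)) ∈ Δ.faces) u v

/-- A simplicial complex is strongly connected if any two facets are joined by a chain of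
facets in which consecutive facets intersect in a face of dimension `dim Δ - 1`. -/
def StronglyConnected : Prop :=
  ∀ σ τ, Δ.IsFacet σ → Δ.IsFacet τ →
    Relation.ReflTransGen
      (fun α β => Δ.IsFacet α ∧ Δ.IsFacet β ∧ ((α ∩ β).card : ℤ) - 1 = Δ.dim - 1) σ τ

/-- A pseudomanifold: strongly connected, and every face of dimension `dim Δ - 1` is
contained in exactly two facets. -/
def IsPseudomanifold : Prop :=
  Δ.StronglyConnected ∧
    ∀ τ ∈ Δ.faces, (τ.card : ℤ) - 1 = Δ.dim - 1 →
      {σ : Finset (Fin n) | Δ.IsFacet σ ∧ τ ⊆ σ}.ncard = 2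

/-- The link of a face `σ` of `Δ`. -/
def link (σ : Finset (Fin n)) (hσ : σ ∈ Δ.faces) : SC n where
  faces := Δ.faces.filter fun τ => τ ∩ σ = ∅ ∧ τ ∪ σ ∈ Δ.faces
  empty_mem := by
    simp only [Finset.mem_filter]
    exact ⟨Δ.empty_mem, by simp, by simpa using hσ⟩
  down_closed := by
    intro σ' τ' h hsub
    simp only [Finset.mem_filter] at h ⊢
    refine ⟨Δ.down_closed h.1 hsub, ?_, ?_⟩
    · have := h.2.1
      rw [Finset.eq_empty_iff_forall_notMem] at this ⊢
      intro x hx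
      exact this x (Finset.mem_inter.mpr
        ⟨hsub (Finset.mem_inter.mp hx).1, (Finset.mem_inter.mp hx).2⟩)
    · exact Δ.down_closed h.2.2 (Finset.union_subset_union hsub (le_refl σ))

/-- A complex is normal if the link of every face of dimension `≤ dim Δ - 2` is connected. -/
def Normal : Prop :=
  ∀ σ (hσ : σ ∈ Δ.faces), (σ.card : ℤ) - 1 ≤ Δ.dim - 2 → (Δ.link σ hσ).Connected

/-! ## Simplicial homology -/

/-- Faces of `Δ` of cardinality `c` containing the face `σ`.  These index a basis of the
`c`-th chain group of the pair `(Δ, cost_Δ σ)` (for `σ = ∅` this is the augmented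
(reduced) chain complex of `Δ`, since the empty face is included in chain degree `0`). -/
def RFace (σ : Finset (Fin n)) (c : ℕ) : Type :=
  {τ : Finset (Fin n) // τ ∈ Δ.faces ∧ σ ⊆ τ ∧ τ.card = c}

instance (σ : Finset (Fin n)) (c : ℕ) : Fintype (Δ.RFace σ c) :=
  inferInstanceAs (Fintype {τ : Finset (Fin n) // τ ∈ Δ.faces ∧ σ ⊆ τ ∧ τ.card = c})

instance (σ : Finset (Fin n)) (c : ℕ) : DecidableEq (Δ.RFace σ c) :=
  inferInstanceAs (DecidableEq {τ : Finset (Fin n) // τ ∈ Δ.faces ∧ σ ⊆ τ ∧ τ.card = c})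

variable (R : Type) [CommRing R]

/-- Chains of the pair `(Δ, cost_Δ σ)` with coefficients in `R`. -/
abbrev relChain (σ : Finset (Fin n)) (c : ℕ) : Type := Δ.RFace σ c → R

/-- The matrix of the simplicial boundary map of the pair `(Δ, cost_Δ σ)`: the coefficient of
`ρ` in `∂ τ` is `(-1)^j` if `ρ` is obtained from `τ` by deleting its `(j+1)`-st vertex (the
deleted vertex not belonging to `σ`), and `0` otherwise. -/
def relBMat (σ : Finset (Fin n)) (i : ℕ) :
    Matrix (Δ.RFace σ i) (Δ.RFace σ (i + 1)) R :=
  fun ρ τ => ∑ v ∈ τ.1, if v ∉ σ ∧ τ.1.erase v = ρ.1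
    then (-1 : R) ^ ((τ.1.filter (fun w => w < v)).card) else 0

/-- The boundary map of the chain complex of the pair `(Δ, cost_Δ σ)`. -/
noncomputable def relBoundary (σ : Finset (Fin n)) (i : ℕ) :
    Δ.relChain R σ (i + 1) →ₗ[R] Δ.relChain R σ i :=
  (Δ.relBMat R σ i).mulVecLin

/-- The relative simplicial homology `H_d(Δ, cost_Δ σ; R)` (`d ≥ 0`). -/
noncomputable def relHomology (σ : Finset (Fin n)) (d : ℕ) : Type :=
  LinearMap.ker (Δ.relBoundary R σ d) ⧸
    Submodule.comap (LinearMap.ker (Δ.relBoundary R σ d)).subtype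
      (LinearMap.range (Δ.relBoundary R σ (d + 1)))

noncomputable instance (σ : Finset (Fin n)) (d : ℕ) : AddCommGroup (Δ.relHomology R σ d) :=
  inferInstanceAs (AddCommGroup (LinearMap.ker (Δ.relBoundary R σ d) ⧸
    Submodule.comap (LinearMap.ker (Δ.relBoundary R σ d)).subtype
      (LinearMap.range (Δ.relBoundary R σ (d + 1)))))

noncomputable instance (σ : Finset (Fin n)) (d : ℕ) : Module R (Δ.relHomology R σ d) :=
  inferInstanceAs (Module R (LinearMap.ker (Δ.relBoundary R σ d) ⧸
    Submodule.comap (LinearMap.ker (Δ.relBoundary R σ d)).subtype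
      (LinearMap.range (Δ.relBoundary R σ (d + 1)))))

/-- Reduced simplicial homology `H̃_d(Δ; R)` for `d ≥ 0`: the homology of the augmented chain
complex, i.e. of the pair `(Δ, cost_Δ ∅)`. -/
noncomputable abbrev reducedHomology (d : ℕ) : Type := Δ.relHomology R ∅ d

/-- Reduced simplicial homology in degree `-1`. -/
noncomputable def reducedHomologyNeg : Type :=
  (⊤ : Submodule R (Δ.relChain R ∅ 0)) ⧸
    Submodule.comap (⊤ : Submodule R (Δ.relChain R ∅ 0)).subtype
      (LinearMap.range (Δ.relBoundary R ∅ 0))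

noncomputable instance : AddCommGroup (Δ.reducedHomologyNeg R) :=
  inferInstanceAs (AddCommGroup ((⊤ : Submodule R (Δ.relChain R ∅ 0)) ⧸
    Submodule.comap (⊤ : Submodule R (Δ.relChain R ∅ 0)).subtype
      (LinearMap.range (Δ.relBoundary R ∅ 0))))

noncomputable instance : Module R (Δ.reducedHomologyNeg R) :=
  inferInstanceAs (Module R ((⊤ : Submodule R (Δ.relChain R ∅ 0)) ⧸
    Submodule.comap (⊤ : Submodule R (Δ.relChain R ∅ 0)).subtype
      (LinearMap.range (Δ.relBoundary R ∅ 0))))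

/-- Cycles of the non-augmented chain complex of `Δ` in dimension `d` (for `d = 0` every
`0`-chain is a cycle). -/
noncomputable def cyclesUnred (d : ℕ) : Submodule R (Δ.relChain R ∅ (d + 1)) :=
  if d = 0 then ⊤ else LinearMap.ker (Δ.relBoundary R ∅ d)

/-- (Unreduced) simplicial homology `H_d(Δ; R)`. -/
noncomputable def homologyUnred (d : ℕ) : Type :=
  Δ.cyclesUnred R d ⧸
    Submodule.comap (Δ.cyclesUnred R d).subtype (LinearMap.range (Δ.relBoundary R ∅ (d + 1)))

noncomputable instance (d : ℕ) : AddCommGroup (Δ.homologyUnred R d) :=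
  inferInstanceAs (AddCommGroup (Δ.cyclesUnred R d ⧸
    Submodule.comap (Δ.cyclesUnred R d).subtype (LinearMap.range (Δ.relBoundary R ∅ (d + 1)))))

noncomputable instance (d : ℕ) : Module R (Δ.homologyUnred R d) :=
  inferInstanceAs (Module R (Δ.cyclesUnred R d ⧸
    Submodule.comap (Δ.cyclesUnred R d).subtype (LinearMap.range (Δ.relBoundary R ∅ (d + 1)))))

/-- `Δ` is `R`-orientable if `H_d(Δ; R) ≠ 0`, where `d = dim Δ`. -/
def Orientable : Prop :=
  ∃ d : ℕ, Δ.dim = (d : ℤ) ∧ Nontrivial (Δ.homologyUnred R d)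

/-- A `k`-homology sphere condition for a single complex `Γ`:
`H̃_i(Γ; k) = k` for `i = dim Γ` and `0` otherwise. -/
def HomologySphereCond (Γ : SC n) : Prop :=
  (∀ i : ℕ, ((i : ℤ) = Γ.dim → Nonempty ((Γ.reducedHomology R i) ≃ₗ[R] R)) ∧
    ((i : ℤ) ≠ Γ.dim → Subsingleton (Γ.reducedHomology R i))) ∧
  ((-1 : ℤ) = Γ.dim → Nonempty ((Γ.reducedHomologyNeg R) ≃ₗ[R] R)) ∧
  ((-1 : ℤ) ≠ Γ.dim → Subsingleton (Γ.reducedHomologyNeg R))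

/-- `Δ` is a `k`-homology manifold: it is connected and the link of every nonempty face has
the reduced homology of a sphere of its dimension. -/
def IsHomologyManifold : Prop :=
  Δ.Connected ∧ ∀ σ (hσ : σ ∈ Δ.faces), σ ≠ ∅ → HomologySphereCond R (Δ.link σ hσ)

/-- `Δ` is isomorphic to the disjoint union of `m` vertices. -/
def IsDisjointVertices (m : ℕ) : Prop :=
  ∃ v : Fin m → Fin n, Function.Injective v ∧
    ∀ σ : Finset (Fin n), σ ∈ Δ.faces ↔ (σ = ∅ ∨ ∃ i, σ = {v i})

/-- `Δ` is isomorphic to a path of length `m` (with `m` edges and `m+1` vertices). -/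
def IsPathComplex (m : ℕ) : Prop :=
  ∃ v : Fin (m + 1) → Fin n, Function.Injective v ∧
    ∀ σ : Finset (Fin n), σ ∈ Δ.faces ↔
      (σ = ∅ ∨ (∃ i, σ = {v i}) ∨ ∃ i : Fin m, σ = {v i.castSucc, v i.succ})

end SC

/-! ## Commutative algebra -/

/-- The `i`-th Ext module `Ext^i_R(M, N)` of two `R`-modules, as an object of `ModuleCat R`. -/
noncomputable def extMod (R : Type) [CommRing R] (M N : Type) [AddCommGroup M] [Module R M]
    [AddCommGroup N] [Module R N] (i : ℕ) : ModuleCat R :=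
  ((Ext R (ModuleCat R) i).obj (Opposite.op (ModuleCat.of R M))).obj (ModuleCat.of R N)

/-- The trace ideal of an `R`-module `M`: the sum of the images of all `R`-linear maps
`M → R`. -/
noncomputable def traceIdeal (R : Type) [CommRing R] (M : Type) [AddCommGroup M] [Module R M] :
    Ideal R :=
  ⨆ f : M →ₗ[R] R, LinearMap.range f

/-- A Noetherian ring `R` with a distinguished maximal ideal `𝔪` (a local ring, or a graded
ring with its graded maximal ideal) is Cohen--Macaulay when `depth = dim`, i.e. (by the
Ext-characterisation of depth) `Ext^i_R(R/𝔪, R) = 0` for all `i < dim R`. -/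
def IsCohenMacaulayAt (R : Type) [CommRing R] (𝔪 : Ideal R) : Prop :=
  IsNoetherianRing R ∧
    ∀ i : ℕ, (i : WithBot (WithTop ℕ)) < ringKrullDim R → Subsingleton (extMod R (R ⧸ 𝔪) R i)

/-- A Noetherian ring `R` with a distinguished maximal ideal `𝔪` (a local ring, or a graded
ring with its graded maximal ideal) is Gorenstein when `Ext^i_R(R/𝔪, R)` vanishes for
`i ≠ dim R` and is isomorphic to `R/𝔪` for `i = dim R`. -/
def IsGorensteinAt (R : Type) [CommRing R] (𝔪 : Ideal R) : Prop :=
  IsNoetherianRing R ∧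
    ∀ i : ℕ, ((i : WithBot (WithTop ℕ)) = ringKrullDim R →
        Nonempty ((extMod R (R ⧸ 𝔪) R i) ≃ₗ[R] (R ⧸ 𝔪))) ∧
      ((i : WithBot (WithTop ℕ)) ≠ ringKrullDim R → Subsingleton (extMod R (R ⧸ 𝔪) R i))

/-- A Noetherian local ring is Gorenstein. -/
def IsGorensteinLocalRing (A : Type) [CommRing A] [IsLocalRing A] : Prop :=
  IsGorensteinAt A (IsLocalRing.maximalIdeal A)

section Graded

variable (k : Type) [Field k] {n : ℕ}

/-- An ideal of a polynomial ring is homogeneous (graded) if it contains all homogeneous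
components of its elements. -/
def IsHomogIdeal (I : Ideal (MvPolynomial (Fin n) k)) : Prop :=
  ∀ p ∈ I, ∀ d : ℕ, MvPolynomial.homogeneousComponent d p ∈ I

/-- The graded (irrelevant) maximal ideal of `k[x_1,…,x_n]/I`, generated by the images of the
variables. -/
noncomputable def quotMax (I : Ideal (MvPolynomial (Fin n) k)) :
    Ideal (MvPolynomial (Fin n) k ⧸ I) :=
  Ideal.span (Set.range fun i : Fin n => Ideal.Quotient.mk I (MvPolynomial.X i))

/-- The degree `j` component of the standard graded ring `k[x_1,…,x_n]/I`, as a
`k`-subspace. -/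
noncomputable def quotGrade (I : Ideal (MvPolynomial (Fin n) k)) (j : ℕ) :
    Submodule k (MvPolynomial (Fin n) k ⧸ I) :=
  (MvPolynomial.homogeneousSubmodule (Fin n) k j).map (Ideal.Quotient.mkₐ k I).toLinearMap

/-- The `ℤ^n`-graded component of `k[x_1,…,x_n]/I` of multidegree `a`: the `k`-line spanned by
the image of the monomial `x^a`. -/
noncomputable def quotMonomialGrade (I : Ideal (MvPolynomial (Fin n) k)) (a : Fin n → ℕ) :
    Submodule k (MvPolynomial (Fin n) k ⧸ I) :=
  Submodule.span k
    {Ideal.Quotient.mk I (MvPolynomial.monomial (Finsupp.equivFunOnFinite.symm a) (1 : k))}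

/-- The standard graded ring `R = k[x_1,…,x_n]/I` is Gorenstein on the punctured spectrum if
`R_𝔭` is Gorenstein for every graded prime `𝔭` other than the graded maximal ideal. -/
def GorensteinPunctured (I : Ideal (MvPolynomial (Fin n) k)) : Prop :=
  ∀ (𝔭 : Ideal (MvPolynomial (Fin n) k ⧸ I)) [𝔭.IsPrime],
    IsHomogIdeal k (𝔭.comap (Ideal.Quotient.mk I)) → 𝔭 ≠ quotMax k I →
      IsGorensteinLocalRing (Localization.AtPrime 𝔭)

/-- `ω` is a canonical module of the standard graded ring `R = k[x_1,…,x_n]/I`, `d = dim R`,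
when `ω ≅ Ext^{n-d}_S(R, S)` for `S = k[x_1,…,x_n]` (by graded local duality this is, up to
shift, the Matlis dual of the top local cohomology module `H^d_𝔪(R)`). -/
def IsCanonicalModuleQ (I : Ideal (MvPolynomial (Fin n) k)) (ω : Type) [AddCommGroup ω]
    [Module (MvPolynomial (Fin n) k ⧸ I) ω] : Prop :=
  Module.Finite (MvPolynomial (Fin n) k ⧸ I) ω ∧
    ∃ d : ℕ, ringKrullDim (MvPolynomial (Fin n) k ⧸ I) = (d : WithBot (WithTop ℕ)) ∧
      letI : Module (MvPolynomial (Fin n) k) ω := Module.compHom ω (Ideal.Quotient.mk I)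
      Nonempty (ω ≃ₗ[MvPolynomial (Fin n) k]
        (extMod (MvPolynomial (Fin n) k) (MvPolynomial (Fin n) k ⧸ I)
          (MvPolynomial (Fin n) k) (n - d)))

/-- A `ℤ`-grading on a module `ω` over `R = k[x_1,…,x_n]/I` compatible with the standard
grading of `R`. -/
def IsCompatibleGrading (I : Ideal (MvPolynomial (Fin n) k)) (ω : Type) [AddCommGroup ω]
    [Module (MvPolynomial (Fin n) k ⧸ I) ω] [Module k ω] (gr : ℤ → Submodule k ω) : Prop :=
  DirectSum.IsInternal gr ∧
    ∀ (i : ℕ) (j : ℤ) (r : MvPolynomial (Fin n) k ⧸ I) (m : ω),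
      r ∈ quotGrade k I i → m ∈ gr j → r • m ∈ gr ((i : ℤ) + j)

/-- The minimal number of generators of a module `M` over `R = k[…]/I` with graded maximal
ideal `𝔪`: the `k`-dimension of `M/𝔪M`. -/
noncomputable def muGen (R : Type) [CommRing R] [Algebra k R] (𝔪 : Ideal R) (M : Type)
    [AddCommGroup M] [Module R M] : ℕ :=
  letI : Module k (M ⧸ (𝔪 • (⊤ : Submodule R M))) :=
    Module.compHom (M ⧸ (𝔪 • (⊤ : Submodule R M))) (algebraMap k R)
  Module.finrank k (M ⧸ (𝔪 • (⊤ : Submodule R M)))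

/-- The Hilbert--Samuel function `j ↦ dim_k M/𝔪^j M` of a module. -/
noncomputable def hilbSam (R : Type) [CommRing R] [Algebra k R] (𝔪 : Ideal R) (M : Type)
    [AddCommGroup M] [Module R M] (j : ℕ) : ℕ :=
  letI : Module k (M ⧸ ((𝔪 ^ j) • (⊤ : Submodule R M))) :=
    Module.compHom (M ⧸ ((𝔪 ^ j) • (⊤ : Submodule R M))) (algebraMap k R)
  Module.finrank k (M ⧸ ((𝔪 ^ j) • (⊤ : Submodule R M)))

/-- `M` is an Ulrich module with respect to `𝔪`: its minimal number of generators `μ(M)`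
equals its multiplicity `e(𝔪; M) = lim_j t!·dim_k(M/𝔪^j M)/j^t`, where `t = dim M`. -/
def IsUlrich (R : Type) [CommRing R] [Algebra k R] (𝔪 : Ideal R) (M : Type) [AddCommGroup M]
    [Module R M] : Prop :=
  ∃ t : ℕ, ringKrullDim (R ⧸ Module.annihilator R M) = (t : WithBot (WithTop ℕ)) ∧
    Filter.Tendsto
      (fun j : ℕ => ((t.factorial : ℝ) * (hilbSam k R 𝔪 M j : ℝ)) / (j : ℝ) ^ t)
      Filter.atTop (nhds ((muGen k R 𝔪 M : ℝ)))

end Graded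

section SR

variable (k : Type) [Field k] {n : ℕ}

/-- The Stanley--Reisner ideal of `Δ`: generated by the squarefree monomials supported on
non-faces of `Δ`. -/
noncomputable def srIdeal (Δ : SC n) : Ideal (MvPolynomial (Fin n) k) :=
  Ideal.span {m | ∃ σ : Finset (Fin n), σ ∉ Δ.faces ∧ m = ∏ i ∈ σ, MvPolynomial.X i}

/-- The Stanley--Reisner ring `k[Δ]`. -/
abbrev SRRing (Δ : SC n) : Type := MvPolynomial (Fin n) k ⧸ srIdeal k Δ

/-- The graded maximal ideal of `k[Δ]`. -/
noncomputable abbrev srMax (Δ : SC n) : Ideal (SRRing k Δ) := quotMax k (srIdeal k Δ)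

/-- The value at `j` of the Hilbert function of the (canonically graded) canonical module of
`k[Δ]`, as computed by Gräbe's theorem:
`dim_k [ω]_j = Σ_{a ∈ ℕ^n, |a| = j} dim_k H_{dim Δ}(Δ, cost_Δ(supp a); k)`. -/
noncomputable def canonicalHilbert (Δ : SC n) (j : ℕ) : ℕ :=
  ∑ a ∈ (Fintype.piFinset fun _ : Fin n => Finset.range (j + 1)).filter
      (fun a => ∑ i, a i = j),
    Module.finrank k
      (Δ.relHomology k (Finset.univ.filter fun i => a i ≠ 0) (Δ.faces.sup Finset.card - 1))

/-- A `ℤ`-grading `gr` on a module `ω` over `k[Δ]` is the canonical grading of the canonical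
module if it is a compatible grading, is supported in nonnegative degrees, and its Hilbert
function is the one given by Gräbe's theorem. -/
def IsCanonicallyGraded (Δ : SC n) (ω : Type) [AddCommGroup ω] [Module (SRRing k Δ) ω]
    [Module k ω] (gr : ℤ → Submodule k ω) : Prop :=
  IsCompatibleGrading k (srIdeal k Δ) ω gr ∧ (∀ j : ℤ, j < 0 → gr j = ⊥) ∧
    ∀ j : ℕ, Module.finrank k (gr (j : ℤ)) = canonicalHilbert k Δ j

/-- A `ℤ^n`-grading `grN` on a module `ω` over `k[Δ]` (supported in `ℕ^n`) is the canonical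
multigrading of the canonical module if it is an internal direct sum, is compatible with the
`ℤ^n`-grading of `k[Δ]`, and its multigraded Hilbert function is the one given by Gräbe's
theorem: `dim_k [ω]_a = dim_k H_{dim Δ}(Δ, cost_Δ(supp a); k)`. -/
def IsCanonicallyMultiGraded (Δ : SC n) (ω : Type) [AddCommGroup ω] [Module (SRRing k Δ) ω]
    [Module k ω] (grN : (Fin n → ℕ) → Submodule k ω) : Prop :=
  DirectSum.IsInternal grN ∧
    (∀ (a b : Fin n → ℕ) (r : SRRing k Δ) (m : ω),
      r ∈ quotMonomialGrade k (srIdeal k Δ) a → m ∈ grN b → r • m ∈ grN (a + b)) ∧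
    ∀ a : Fin n → ℕ, Module.finrank k (grN a) =
      Module.finrank k
        (Δ.relHomology k (Finset.univ.filter fun i => a i ≠ 0) (Δ.faces.sup Finset.card - 1))

end SR

/-- The chain map `C_•(Δ, cost_Δ τ) → C_•(Δ, cost_Δ σ)` (for `τ ⊆ σ`) induced by the
inclusion `cost_Δ τ ⊆ cost_Δ σ`: basis faces not containing `σ` are sent to `0`. -/
def SC.relChainMap {n : ℕ} (Δ : SC n) (R : Type) [CommRing R] (τ σ : Finset (Fin n)) (c : ℕ) :
    Δ.relChain R τ c →ₗ[R] Δ.relChain R σ c :=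
  Matrix.mulVecLin (fun (β : Δ.RFace σ c) (α : Δ.RFace τ c) => if α.1 = β.1 then (1 : R) else 0)

set_option synthInstance.maxHeartbeats 1000000 in
/-- `R = k[x_1,…,x_n]/I` is almost Gorenstein with respect to a canonical module `ω` with
(canonical) grading `gr`: writing `a = a_R` for the `a`-invariant (so `-a` is the least degree
of `ω`), there is an injective degree-zero `R`-linear map `φ : R → ω(-a)` whose cokernel is
zero or an Ulrich module. -/
def IsAlmostGorenstein (k : Type) [Field k] {n : ℕ} (I : Ideal (MvPolynomial (Fin n) k))
    (ω : Type) [AddCommGroup ω] [Module (MvPolynomial (Fin n) k ⧸ I) ω] [Module k ω]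
    (gr : ℤ → Submodule k ω) : Prop :=
  ∃ a : ℤ, (gr (-a) ≠ ⊥ ∧ ∀ j : ℤ, j < -a → gr j = ⊥) ∧
    ∃ φ : (MvPolynomial (Fin n) k ⧸ I) →ₗ[MvPolynomial (Fin n) k ⧸ I] ω,
      Function.Injective φ ∧
      (∀ (i : ℕ) (r : MvPolynomial (Fin n) k ⧸ I),
        r ∈ quotGrade k I i → φ r ∈ gr ((i : ℤ) - a)) ∧
      (Subsingleton (ω ⧸ LinearMap.range φ) ∨
        IsUlrich k (MvPolynomial (Fin n) k ⧸ I) (quotMax k I) (ω ⧸ LinearMap.range φ))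



namespace GP

section CAR
variable {n : ℕ} {R : Type} [CommRing R]

/-- sign -/
def sg (R : Type) [CommRing R] (G : Finset (Fin n)) (v : Fin n) : R :=
  (-1) ^ (G.filter (fun w => w < v)).card

lemma sg_mul_self (G : Finset (Fin n)) (v : Fin n) : sg R G v * sg R G v = 1 := by
  unfold sg
  rw [← pow_add, ← two_mul, pow_mul]; simp

lemma sg_insert {u : Fin n} {G : Finset (Fin n)} (h : u ∉ G) (v : Fin n) :
    sg R (insert u G) v = (if u < v then -1 else 1) * sg R G v := by
  unfold sg
  rw [Finset.filter_insert]
  split_ifs with huv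
  · rw [Finset.card_insert_of_notMem (by simp [h]), pow_succ]; ring
  · simp

lemma sg_erase_self (G : Finset (Fin n)) (v : Fin n) : sg R (G.erase v) v = sg R G v := by
  unfold sg
  congr 2
  ext w
  simp only [Finset.mem_filter, Finset.mem_erase]
  constructor
  · rintro ⟨⟨_, h⟩, h'⟩; exact ⟨h, h'⟩
  · rintro ⟨h, h'⟩; exact ⟨⟨ne_of_lt h', h⟩, h'⟩

lemma sg_insert_self (G : Finset (Fin n)) (v : Fin n) : sg R (insert v G) v = sg R G v := by
  rw [← sg_erase_self (insert v G), ← sg_erase_self G, Finset.erase_insert_eq_erase]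

lemma sg_erase {u : Fin n} {G : Finset (Fin n)} (h : u ∈ G) (v : Fin n) :
    sg R (G.erase u) v = (if u < v then -1 else 1) * sg R G v := by
  conv_rhs => rw [← Finset.insert_erase h, sg_insert (Finset.notMem_erase u G)]
  split_ifs <;> ring

/-- creation -/
def Ev (v : Fin n) : (Finset (Fin n) → R) →ₗ[R] (Finset (Fin n) → R) where
  toFun f S := if v ∈ S then sg R S v * f (S.erase v) else 0
  map_add' f g := by ext S; simp only [Pi.add_apply]; split_ifs <;> ring
  map_smul' a f := by ext S; simp only [Pi.smul_apply, smul_eq_mul, RingHom.id_apply]; split_ifs <;> ring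

/-- annihilation -/
def Cv (v : Fin n) : (Finset (Fin n) → R) →ₗ[R] (Finset (Fin n) → R) where
  toFun f S := if v ∈ S then 0 else sg R S v * f (insert v S)
  map_add' f g := by ext S; simp only [Pi.add_apply]; split_ifs <;> ring
  map_smul' a f := by ext S; simp only [Pi.smul_apply, smul_eq_mul, RingHom.id_apply]; split_ifs <;> ring

lemma Ev_apply (v : Fin n) (f : Finset (Fin n) → R) (S) :
    Ev v f S = if v ∈ S then sg R S v * f (S.erase v) else 0 := rfl
lemma Cv_apply (v : Fin n) (f : Finset (Fin n) → R) (S) :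
    Cv v f S = if v ∈ S then 0 else sg R S v * f (insert v S) := rfl

lemma Ev_Ev_self (v : Fin n) (f : Finset (Fin n) → R) : Ev v (Ev v f) = 0 := by
  ext S; simp [Ev_apply]

lemma Cv_Cv_self (v : Fin n) (f : Finset (Fin n) → R) : Cv v (Cv v f) = 0 := by
  ext S; simp [Cv_apply]

lemma Cv_Ev_self (v : Fin n) (f : Finset (Fin n) → R) : Cv v (Ev v f) + Ev v (Cv v f) = f := by
  ext S
  by_cases h : v ∈ S
  · simp [Ev_apply, Cv_apply, h, sg_erase_self, ← mul_assoc, sg_mul_self]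
  · simp [Ev_apply, Cv_apply, h, sg_insert_self, ← mul_assoc, sg_mul_self]

lemma Ev_Ev {u v : Fin n} (huv : u ≠ v) (f : Finset (Fin n) → R) :
    Ev u (Ev v f) = - Ev v (Ev u f) := by
  ext S
  by_cases hu : u ∈ S <;> by_cases hv : v ∈ S <;>
    simp only [Ev_apply, Pi.neg_apply, hu, hv, Finset.mem_erase, huv, huv.symm, if_true, if_false, and_true,
      and_false, neg_zero, mul_zero, ne_eq, not_false_eq_true]
  rw [Finset.erase_right_comm (a := u), sg_erase hu, sg_erase hv]
  rcases lt_or_gt_of_ne huv with h | h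
  · simp [h, h.le.not_gt]; ring
  · simp [h, h.le.not_gt]; ring

lemma Cv_Cv {u v : Fin n} (huv : u ≠ v) (f : Finset (Fin n) → R) :
    Cv u (Cv v f) = - Cv v (Cv u f) := by
  ext S
  by_cases hu : u ∈ S <;> by_cases hv : v ∈ S <;>
    simp only [Cv_apply, Pi.neg_apply, hu, hv, Finset.mem_insert, huv, huv.symm, if_true, if_false, or_true,
      or_false, neg_zero, mul_zero]
  rw [Finset.insert_comm, sg_insert hu, sg_insert hv]
  rcases lt_or_gt_of_ne huv with h | h
  · simp [h, h.le.not_gt]; ring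
  · simp [h, h.le.not_gt]; ring

lemma Cv_Ev {u v : Fin n} (huv : u ≠ v) (f : Finset (Fin n) → R) :
    Cv u (Ev v f) = - Ev v (Cv u f) := by
  ext S
  by_cases hu : u ∈ S <;> by_cases hv : v ∈ S <;>
    simp only [Cv_apply, Ev_apply, Pi.neg_apply, hu, hv, Finset.mem_insert, Finset.mem_erase, huv, huv.symm, if_true, if_false, or_true,
      or_false, neg_zero, mul_zero, ne_eq, not_false_eq_true, and_true, and_false]
  rw [Finset.erase_insert_of_ne huv, sg_insert hu, sg_erase hv]
  rcases lt_or_gt_of_ne huv with h | h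
  · simp [h, h.le.not_gt]; ring
  · simp [h, h.le.not_gt]; ring

/-- contraction by `y` -/
def Dy (y : Fin n → R) : (Finset (Fin n) → R) →ₗ[R] (Finset (Fin n) → R) := ∑ i, y i • Cv i
/-- wedge with `y` -/
def dy (y : Fin n → R) : (Finset (Fin n) → R) →ₗ[R] (Finset (Fin n) → R) := ∑ i, y i • Ev i

lemma Dy_eq (y : Fin n → R) (f) : Dy y f = ∑ i, y i • Cv i f := by
  simp [Dy, LinearMap.sum_apply]
lemma dy_eq (y : Fin n → R) (f) : dy y f = ∑ i, y i • Ev i f := by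
  simp [dy, LinearMap.sum_apply]
lemma Dy_apply (y : Fin n → R) (f S) : Dy y f S = ∑ i, y i * Cv i f S := by
  simp [Dy_eq]
lemma dy_apply (y : Fin n → R) (f S) : dy y f S = ∑ i, y i * Ev i f S := by
  simp [dy_eq]

lemma Dy_Cv (y : Fin n → R) (v : Fin n) (f) : Dy y (Cv v f) = - Cv v (Dy y f) := by
  rw [Dy_eq, Dy_eq, map_sum, ← Finset.sum_neg_distrib]
  refine Finset.sum_congr rfl fun i _ => ?_
  rw [map_smul]
  by_cases h : i = v
  · subst h; simp [Cv_Cv_self]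
  · rw [Cv_Cv h, smul_neg]

lemma Dy_Ev (y : Fin n → R) (v : Fin n) (f) : Dy y (Ev v f) + Ev v (Dy y f) = y v • f := by
  rw [Dy_eq, Dy_eq, map_sum, ← Finset.sum_add_distrib]
  rw [Finset.sum_eq_single v]
  · rw [map_smul, ← smul_add, Cv_Ev_self]
  · intro i _ h
    rw [Cv_Ev h, map_smul]; simp
  · simp

lemma dy_Ev (y : Fin n → R) (v : Fin n) (f) : dy y (Ev v f) = - Ev v (dy y f) := by
  rw [dy_eq, dy_eq, map_sum, ← Finset.sum_neg_distrib]
  refine Finset.sum_congr rfl fun i _ => ?_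
  rw [map_smul]
  by_cases h : i = v
  · subst h; simp [Ev_Ev_self]
  · rw [Ev_Ev h, smul_neg]

lemma dy_Cv (y : Fin n → R) (v : Fin n) (f) : dy y (Cv v f) + Cv v (dy y f) = y v • f := by
  rw [dy_eq, dy_eq, map_sum, ← Finset.sum_add_distrib]
  rw [Finset.sum_eq_single v]
  · rw [map_smul, ← smul_add, add_comm, Cv_Ev_self]
  · intro i _ h
    rw [map_smul, Cv_Ev (Ne.symm h)]; simp
  · simp

lemma antisymm_sum (a : Fin n → Fin n → (Finset (Fin n) → R)) (h0 : ∀ i, a i i = 0)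
    (h : ∀ i j, i ≠ j → a i j = - a j i) : ∑ i, ∑ j, a i j = 0 := by
  classical
  rw [← Finset.sum_product']
  refine Finset.sum_involution (fun p _ => (p.2, p.1)) ?_ ?_ (by simp) (by simp)
  · rintro ⟨i, j⟩ _
    by_cases hij : i = j
    · subst hij; simp [h0]
    · simp [h i j hij]
  · rintro ⟨i, j⟩ _ hne heq
    simp only [Prod.mk.injEq] at heq
    apply hne
    rw [← heq.1]; exact h0 _

lemma Dy_Dy (y : Fin n → R) (f) : Dy y (Dy y f) = 0 := by
  rw [Dy_eq y f, map_sum]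
  simp_rw [map_smul, Dy_eq, Finset.smul_sum]
  apply antisymm_sum
  · intro i; simp [Cv_Cv_self]
  · intro i j hij; rw [Cv_Cv hij.symm, smul_comm]; simp

lemma dy_dy (y : Fin n → R) (f) : dy y (dy y f) = 0 := by
  rw [dy_eq y f, map_sum]
  simp_rw [map_smul, dy_eq, Finset.smul_sum]
  apply antisymm_sum
  · intro i; simp [Ev_Ev_self]
  · intro i j hij; rw [Ev_Ev hij.symm, smul_comm]; simp

/-- pairing -/
def pr (f g : Finset (Fin n) → R) : R := ∑ S, f S * g S

lemma pr_Cv (v : Fin n) (f g : Finset (Fin n) → R) : pr f (Cv v g) = pr (Ev v f) g := by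
  classical
  unfold pr
  have h1 : ∑ S, f S * Cv v g S = ∑ S ∈ Finset.univ.filter (fun S : Finset (Fin n) => v ∉ S), f S * Cv v g S := by
    rw [Finset.sum_filter]; refine Finset.sum_congr rfl fun S _ => ?_
    by_cases h : v ∈ S <;> simp [Cv_apply, h]
  have h2 : ∑ S, Ev v f S * g S = ∑ S ∈ Finset.univ.filter (fun S : Finset (Fin n) => v ∈ S), Ev v f S * g S := by
    rw [Finset.sum_filter]; refine Finset.sum_congr rfl fun S _ => ?_
    by_cases h : v ∈ S <;> simp [Ev_apply, h]
  rw [h1, h2]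
  refine Finset.sum_bij' (fun S _ => insert v S) (fun S _ => S.erase v) ?_ ?_ ?_ ?_ ?_
  · intro S _; simp
  · intro S _; simp
  · intro S hS; simp at hS; simp [hS]
  · intro S hS; simp at hS; simp [hS]
  · intro S hS
    simp at hS
    simp [Cv_apply, Ev_apply, hS, sg_insert_self]; ring

lemma pr_sum_right {ι : Type*} (s : Finset ι) (f : Finset (Fin n) → R) (g : ι → Finset (Fin n) → R) :
    pr f (∑ i ∈ s, g i) = ∑ i ∈ s, pr f (g i) := by
  unfold pr
  rw [Finset.sum_comm]
  simp [Finset.mul_sum]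

lemma pr_sum_left {ι : Type*} (s : Finset ι) (f : Finset (Fin n) → R) (g : ι → Finset (Fin n) → R) :
    pr (∑ i ∈ s, g i) f = ∑ i ∈ s, pr (g i) f := by
  unfold pr
  rw [Finset.sum_comm]
  simp [Finset.sum_mul]

lemma pr_smul_right (a : R) (f g : Finset (Fin n) → R) : pr f (a • g) = a * pr f g := by
  simp [pr, Finset.mul_sum, mul_left_comm]
lemma pr_smul_left (a : R) (f g : Finset (Fin n) → R) : pr (a • f) g = a * pr f g := by
  simp [pr, Finset.mul_sum, mul_assoc]

lemma pr_Dy (y : Fin n → R) (f g : Finset (Fin n) → R) : pr f (Dy y g) = pr (dy y f) g := by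
  rw [Dy_eq, dy_eq, pr_sum_right, pr_sum_left]
  simp [pr_smul_right, pr_smul_left, pr_Cv]

end CAR
end GP


namespace GP

section HA
variable {A : Type} [CommRing A]

/-- the module-theoretic predicate used to transport `= 0` and `rank ≤ 1`. -/
def QP (s : Set (A × A)) (M : Type) [AddCommGroup M] [Module A M] : Prop :=
  ∀ ξ ξ' : M, ∃ p ∈ s, p.1 • ξ + p.2 • ξ' = 0

/-- Abelian Ext with values in the ring. -/
abbrev XT (A : Type) [CommRing A] (M : Type) [AddCommGroup M] [Module A M] (i : ℕ) : Type :=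
  Abelian.Ext (ModuleCat.of A M) (ModuleCat.of A A) i

lemma ses {N₁ N₂ N₃ : Type} [AddCommGroup N₁] [Module A N₁] [AddCommGroup N₂] [Module A N₂]
    [AddCommGroup N₃] [Module A N₃] (f : N₁ →ₗ[A] N₂) (g : N₂ →ₗ[A] N₃)
    (hf : Function.Injective f) (hg : Function.Surjective g) (h : Function.Exact f g) :
    (ShortComplex.mk (ModuleCat.ofHom f) (ModuleCat.ofHom g)
      (by ext x; exact h.apply_apply_eq_zero x)).ShortExact :=
  { exact := (ShortComplex.ShortExact.moduleCat_exact_iff_function_exact _).2 h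
    mono_f := (ModuleCat.mono_iff_injective _).2 hf
    epi_g := (ModuleCat.epi_iff_surjective _).2 hg }

section LE
variable {N₁ N₂ N₃ : Type} [AddCommGroup N₁] [Module A N₁] [AddCommGroup N₂] [Module A N₂]
    [AddCommGroup N₃] [Module A N₃] (f : N₁ →ₗ[A] N₂) (g : N₂ →ₗ[A] N₃)
    (hf : Function.Injective f) (hg : Function.Surjective g) (h : Function.Exact f g)
include hf hg h

lemma XT_sub₂ (i : ℕ) (h1 : Subsingleton (XT A N₁ i)) (h3 : Subsingleton (XT A N₃ i)) :
    Subsingleton (XT A N₂ i) := by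
  refine subsingleton_of_forall_eq 0 fun x => ?_
  obtain ⟨y, hy⟩ := Abelian.Ext.contravariant_sequence_exact₂ (ses f g hf hg h) _ x
    (Subsingleton.elim (α := XT A N₁ i) _ _)
  rw [← hy, show y = 0 from Subsingleton.elim (α := XT A N₃ i) _ _]
  simp

lemma XT_Q_left (s : Set (A × A)) (i : ℕ) [Module.Projective A N₂] (hi : 1 ≤ i) (h3 : QP s (XT A N₃ (i + 1))) :
    QP s (XT A N₁ i) := by
  intro ξ ξ'
  have hS := ses f g hf hg h
  obtain ⟨p, hp, hp'⟩ := h3 (hS.extClass.comp ξ (add_comm 1 i)) (hS.extClass.comp ξ' (add_comm 1 i))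
  refine ⟨p, hp, ?_⟩
  rw [← Abelian.Ext.comp_smul, ← Abelian.Ext.comp_smul, ← Abelian.Ext.comp_add] at hp'
  obtain ⟨x, hx⟩ := Abelian.Ext.contravariant_sequence_exact₁ hS _ _ _ hp'
  obtain ⟨i, rfl⟩ : ∃ i', i = i' + 1 := ⟨i - 1, by omega⟩
  have : Projective (ModuleCat.of A N₂) := inferInstance
  rw [← hx, show x = 0 from Abelian.Ext.eq_zero_of_projective (P := ModuleCat.of A N₂) x]
  simp

lemma XT_Q_mid (s : Set (A × A)) (i : ℕ) (h1 : Subsingleton (XT A N₁ i)) (h3 : QP s (XT A N₃ i)) :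
    QP s (XT A N₂ i) := by
  intro ξ ξ'
  have hS := ses f g hf hg h
  obtain ⟨x, hx⟩ := Abelian.Ext.contravariant_sequence_exact₂ hS _ ξ (Subsingleton.elim (α := XT A N₁ i) _ _)
  obtain ⟨x', hx'⟩ := Abelian.Ext.contravariant_sequence_exact₂ hS _ ξ' (Subsingleton.elim (α := XT A N₁ i) _ _)
  obtain ⟨p, hp, hp'⟩ := h3 x x'
  refine ⟨p, hp, ?_⟩
  rw [← hx, ← hx', ← Abelian.Ext.comp_smul, ← Abelian.Ext.comp_smul, ← Abelian.Ext.comp_add]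
  erw [hp']
  simp

lemma XT_lift (s : Set (A × A)) (h3 : QP s (XT A N₃ 1)) (β β' : N₁ →ₗ[A] A) :
    ∃ p ∈ s, ∃ ψ : N₂ →ₗ[A] A, ∀ x, p.1 * β x + p.2 * β' x = ψ (f x) := by
  have hS := ses f g hf hg h
  obtain ⟨p, hp, hp'⟩ := h3 (hS.extClass.comp (Abelian.Ext.mk₀ (ModuleCat.ofHom β)) (add_zero 1))
    (hS.extClass.comp (Abelian.Ext.mk₀ (ModuleCat.ofHom β')) (add_zero 1))
  refine ⟨p, hp, ?_⟩
  rw [← Abelian.Ext.comp_smul, ← Abelian.Ext.comp_smul, ← Abelian.Ext.comp_add] at hp'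
  obtain ⟨x, hx⟩ := Abelian.Ext.contravariant_sequence_exact₁ hS _ _ _ hp'
  obtain ⟨ψ, rfl⟩ := Abelian.Ext.addEquiv₀.symm.surjective x
  have h2 : ModuleCat.ofHom f ≫ ψ = p.1 • ModuleCat.ofHom β + p.2 • ModuleCat.ofHom β' := by
    apply Abelian.Ext.addEquiv₀.symm.injective
    simp only [Abelian.Ext.addEquiv₀_symm_apply, Abelian.Ext.mk₀_comp_mk₀] at hx ⊢
    rw [hx, Abelian.Ext.mk₀_add, Abelian.Ext.mk₀_smul, Abelian.Ext.mk₀_smul]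
  refine ⟨ψ.hom, fun x => ?_⟩
  have := congrArg (fun q => q.hom x) h2
  simpa using this.symm

end LE

lemma XT_iso_Q {N N' : Type} [AddCommGroup N] [Module A N] [AddCommGroup N'] [Module A N']
    (s : Set (A × A)) (e : N ≃ₗ[A] N') (i : ℕ) (h : QP s (XT A N i)) : QP s (XT A N' i) := by
  refine XT_Q_mid (N₁ := PUnit) (N₂ := N') (N₃ := N) 0 e.symm.toLinearMap
    (fun _ _ _ => rfl) e.symm.surjective ?_ s i ?_ h
  · intro x
    simp
    exact ⟨fun h => h.symm, fun h => h.symm⟩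
  · refine subsingleton_of_forall_eq 0 fun x => ?_
    rw [← Abelian.Ext.mk₀_id_comp x, show 𝟙 (ModuleCat.of A PUnit) = 0 by ext]
    simp

lemma QP_sub (M : Type) [AddCommGroup M] [Module A M] : QP {((1 : A), (0 : A))} M ↔ Subsingleton M := by
  constructor
  · intro h
    refine subsingleton_of_forall_eq 0 fun x => ?_
    obtain ⟨p, hp, h⟩ := h x 0
    rw [Set.mem_singleton_iff] at hp
    simpa [hp] using h
  · intro h x y
    exact ⟨_, rfl, Subsingleton.elim _ _⟩

lemma XT_killed [IsNoetherianRing A] (m : Ideal A) [hm : m.IsMaximal] (i : ℕ)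
    (hK : Subsingleton (XT A (A ⧸ m) i)) (N : Type) [AddCommGroup N] [Module A N] [Module.Finite A N]
    (hN : ∀ a ∈ m, ∀ x : N, a • x = 0) : Subsingleton (XT A N i) := by
  revert hN
  refine IsNoetherianRing.induction_on_isQuotientEquivQuotientPrime A (M := N) inferInstance
    (motive := fun N _ _ _ => (∀ a ∈ m, ∀ x : N, a • x = 0) → Subsingleton (XT A N i)) ?_ ?_ ?_
  · intro N _ _ _ _ _
    refine subsingleton_of_forall_eq 0 fun x => ?_
    rw [← Abelian.Ext.mk₀_id_comp x, show 𝟙 (ModuleCat.of A N) = 0 by ext x; exact Subsingleton.elim _ _]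
    simp
  · intro N _ _ _ p e hN
    have : m ≤ p.1 := by
      intro a ha
      have := congrArg e (hN a ha (e.symm 1))
      rw [map_smul, LinearEquiv.apply_symm_apply, map_zero, Algebra.smul_def, mul_one] at this
      exact Ideal.Quotient.eq_zero_iff_mem.1 this
    have h2 : m = p.1 := hm.eq_of_le p.2.ne_top this
    rw [← QP_sub (A := A)] at hK ⊢
    refine XT_iso_Q _ ?_ i hK
    exact (Submodule.quotEquivOfEq _ _ h2).trans e.symm
  · intro N₁ _ _ _ N₂ _ _ _ N₃ _ _ _ f g hf hg hfg h1 h3 hN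
    refine XT_sub₂ f g hf hg hfg i (h1 ?_) (h3 ?_)
    · intro a ha x
      apply hf
      rw [map_smul, hN a ha, map_zero]
    · intro a ha x
      obtain ⟨y, rfl⟩ := hg x
      rw [← map_smul, hN a ha, map_zero]

section Complex
variable [IsNoetherianRing A] (m : Ideal A) [hm : m.IsMaximal]
  (F : ℕ → Type) [∀ q, AddCommGroup (F q)] [∀ q, Module A (F q)] [∀ q, Module.Projective A (F q)]
  [∀ q, Module.Finite A (F q)] (d : ∀ q, F (q + 1) →ₗ[A] F q)
  (dd : ∀ q x, d q (d (q + 1) x) = 0)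
  (hH : ∀ q (x : F (q + 1)), d q x = 0 → ∀ a ∈ m, a • x ∈ LinearMap.range (d (q + 1)))
  (e : ℕ) (hK : ∀ i < e, Subsingleton (XT A (A ⧸ m) i))
include dd hH hK

lemma cx_step (s : Set (A × A)) (q i : ℕ) (hi : 1 ≤ i) (hie : i < e)
    (h : QP s (XT A (F q ⧸ LinearMap.range (d q)) (i + 1))) :
    QP s (XT A (F (q + 1) ⧸ LinearMap.range (d (q + 1))) i) := by
  have h1 : QP s (XT A (LinearMap.range (d q)) i) := by
    refine XT_Q_left (LinearMap.range (d q)).subtype (LinearMap.range (d q)).mkQ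
      (Submodule.subtype_injective _) (Submodule.mkQ_surjective _) ?_ s i hi h
    exact LinearMap.exact_subtype_mkQ _
  have hle : LinearMap.range (d (q + 1)) ≤ LinearMap.ker (d q).rangeRestrict := by
    rintro _ ⟨x, rfl⟩
    rw [LinearMap.ker_rangeRestrict]
    exact dd q x
  let g := (LinearMap.range (d (q + 1))).liftQ (d q).rangeRestrict hle
  refine XT_Q_mid (LinearMap.ker g).subtype g (Submodule.subtype_injective _) ?_ ?_ s i ?_ h1
  · intro y
    obtain ⟨x, hx⟩ := (d q).surjective_rangeRestrict y
    exact ⟨Submodule.Quotient.mk x, hx⟩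
  · exact LinearMap.exact_subtype_ker_map g
  · refine XT_killed m i (hK i hie) _ ?_
    rintro a ha ⟨x, hx⟩
    obtain ⟨x, rfl⟩ := Submodule.mkQ_surjective _ x
    ext
    simp only [Submodule.coe_smul, ZeroMemClass.coe_zero]
    rw [← map_smul, Submodule.mkQ_apply, Submodule.Quotient.mk_eq_zero]
    apply hH q x _ a ha
    have : g (Submodule.Quotient.mk x) = 0 := hx
    exact congrArg Subtype.val this

lemma cx_main (s : Set (A × A)) (hC0 : (A ⧸ m) ≃ₗ[A] (F 0 ⧸ LinearMap.range (d 0)))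
    (hsoc : ∀ x : A, (∀ a ∈ m, a * x = 0) → x = 0)
    (j : ℕ) (hj : j + 1 ≤ e) (hQ : QP s (XT A (A ⧸ m) (j + 1)))
    (φ φ' : F (j + 1) →ₗ[A] A) (hφ : ∀ x, φ (d (j + 1) x) = 0) (hφ' : ∀ x, φ' (d (j + 1) x) = 0) :
    ∃ p ∈ s, ∃ ψ : F j →ₗ[A] A, ∀ x, p.1 * φ x + p.2 * φ' x = ψ (d j x) := by
  have key : ∀ q i, 1 ≤ i → q + i = j + 1 → QP s (XT A (F q ⧸ LinearMap.range (d q)) i) := by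
    intro q
    induction q with
    | zero =>
      intro i hi hqi
      have : i = j + 1 := by omega
      subst this
      exact XT_iso_Q s hC0 _ hQ
    | succ q ih =>
      intro i hi hqi
      exact cx_step m F d dd hH e hK s q i hi (by omega) (ih (i + 1) (by omega) (by omega))
  have fac : ∀ φ : F (j + 1) →ₗ[A] A, (∀ x, φ (d (j + 1) x) = 0) →
      ∃ β : LinearMap.range (d j) →ₗ[A] A, ∀ x, β ((d j).rangeRestrict x) = φ x := by
    intro φ hφ
    have hk : LinearMap.ker (d j).rangeRestrict ≤ LinearMap.ker φ := by
      intro x hx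
      rw [LinearMap.ker_rangeRestrict] at hx
      apply hsoc
      intro a ha
      obtain ⟨y, hy⟩ := hH j x hx a ha
      rw [← smul_eq_mul, ← map_smul, ← hy, hφ]
    refine ⟨((LinearMap.ker (d j).rangeRestrict).liftQ φ hk).comp
      ((d j).rangeRestrict.quotKerEquivOfSurjective (d j).surjective_rangeRestrict).symm.toLinearMap, ?_⟩
    intro x
    have : ((d j).rangeRestrict.quotKerEquivOfSurjective (d j).surjective_rangeRestrict).symm
      ((d j).rangeRestrict x) = Submodule.Quotient.mk x := by
      rw [LinearEquiv.symm_apply_eq]; rfl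
    simp only [LinearMap.comp_apply, LinearEquiv.coe_coe]
    rw [this]; rfl
  obtain ⟨β, hβ⟩ := fac φ hφ
  obtain ⟨β', hβ'⟩ := fac φ' hφ'
  obtain ⟨p, hp, ψ, hψ⟩ := XT_lift (LinearMap.range (d j)).subtype (LinearMap.range (d j)).mkQ
      (Submodule.subtype_injective _) (Submodule.mkQ_surjective _) (LinearMap.exact_subtype_mkQ _) s
      (key j 1 le_rfl rfl) β β'
  refine ⟨p, hp, ψ, fun x => ?_⟩
  rw [← hβ, ← hβ', hψ]; rfl

end Complex

end HA
end GP


namespace GP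

section ExtComp
variable {A : Type} [CommRing A]

lemma QP_equiv {s : Set (A × A)} {M N : Type} [AddCommGroup M] [Module A M] [AddCommGroup N] [Module A N]
    (e : M ≃ₗ[A] N) (h : QP s M) : QP s N := by
  intro x y
  obtain ⟨p, hp, h⟩ := h (e.symm x) (e.symm y)
  refine ⟨p, hp, e.symm.injective ?_⟩
  simpa using h

lemma sc_QP (s : Set (A × A)) (S : ShortComplex (ModuleCat.{0} A)) (h : QP s S.homology)
    (x x' : S.X₂) (hx : S.g x = 0) (hx' : S.g x' = 0) :
    ∃ p ∈ s, ∃ w, S.f w = p.1 • x + p.2 • x' := by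
  have h2 : QP s (LinearMap.ker S.g.hom ⧸ LinearMap.range S.moduleCatToCycles) :=
    QP_equiv (S.moduleCatHomologyIso.toLinearEquiv) h
  obtain ⟨p, hp, h3⟩ := h2 (Submodule.Quotient.mk ⟨x, hx⟩) (Submodule.Quotient.mk ⟨x', hx'⟩)
  refine ⟨p, hp, ?_⟩
  rw [← Submodule.Quotient.mk_smul, ← Submodule.Quotient.mk_smul, ← Submodule.Quotient.mk_add,
    Submodule.Quotient.mk_eq_zero] at h3
  obtain ⟨w, hw⟩ := h3
  exact ⟨w, congrArg Subtype.val hw⟩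

lemma smul_extMk {X : ModuleCat.{0} A} {Y : ModuleCat.{0} A} (P : ProjectiveResolution X) {i : ℕ}
    (f : P.complex.X i ⟶ Y) (m : ℕ) (hm : i + 1 = m) (hf : P.complex.d m i ≫ f = 0) (a : A) :
    a • P.extMk f m hm hf = P.extMk (a • f) m hm (by simp [hf]) := by
  rw [Abelian.Ext.smul_eq_comp_mk₀, P.extMk_comp_mk₀]
  congr 1

lemma XT_of_extMod (s : Set (A × A)) (N : Type) [AddCommGroup N] [Module A N] (i : ℕ)
    (h : QP s (extMod A N A i)) : QP s (XT A N i) := by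
  intro ξ ξ'
  let P := projectiveResolution (ModuleCat.of A N)
  obtain ⟨f, hf, rfl⟩ := P.extMk_surjective ξ (i + 1) rfl
  obtain ⟨f', hf', rfl⟩ := P.extMk_surjective ξ' (i + 1) rfl
  let K := P.complex.linearYonedaObj A (ModuleCat.of A A)
  have h1 : QP s (K.homology i) := QP_equiv (P.isoExt i (ModuleCat.of A A)).toLinearEquiv h
  have key : ∃ p ∈ s, (∃ j, ∃ _ : j + 1 = i, ∃ g : P.complex.X j ⟶ ModuleCat.of A A, P.complex.d i j ≫ g = p.1 • f + p.2 • f') ∨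
      (p.1 • f + p.2 • f' = 0) := by
    cases i with
    | zero =>
      obtain ⟨p, hp, w, hw⟩ := sc_QP s (K.sc 0) h1 f f' (by
        change (K.d 0 _) f = 0
        have e : (ComplexShape.up ℕ).next 0 = 1 := by simp
        rw [e]
        exact hf) (by
        change (K.d 0 _) f' = 0
        have e : (ComplexShape.up ℕ).next 0 = 1 := by simp
        rw [e]
        exact hf')
      refine ⟨p, hp, Or.inr ?_⟩
      have : (K.sc 0).f = 0 := K.shape _ _ (by simp)
      rw [this] at hw
      exact hw.symm
    | succ j =>
      have h2 : QP s ((K.sc' j (j + 1) (j + 1 + 1)).homology) :=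
        QP_equiv (ShortComplex.homologyMapIso (K.isoSc' j (j + 1) (j + 1 + 1) (by simp) (by simp))).toLinearEquiv h1
      obtain ⟨p, hp, w, hw⟩ := sc_QP s _ h2 f f' hf hf'
      exact ⟨p, hp, Or.inl ⟨j, rfl, w, hw⟩⟩
  obtain ⟨p, hp, h⟩ := key
  refine ⟨p, hp, ?_⟩
  rw [smul_extMk, smul_extMk, P.add_extMk]
  rcases h with ⟨j, hj, g, hg⟩ | h
  · rw [P.extMk_eq_zero_iff _ _ _ _ j hj]
    exact ⟨g, hg⟩
  · simp only [h]
    simp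

/-- Gorenstein-type hypothesis in usable form. -/
lemma gor_out [IsLocalRing A] (hG : IsGorensteinLocalRing A) (e : ℕ)
    (he : (e : WithBot (WithTop ℕ)) ≤ ringKrullDim A) :
    (∀ i < e, Subsingleton (XT A (A ⧸ IsLocalRing.maximalIdeal A) i)) ∧
    QP {p : A × A | p.1 ∉ IsLocalRing.maximalIdeal A ∨ p.2 ∉ IsLocalRing.maximalIdeal A}
      (XT A (A ⧸ IsLocalRing.maximalIdeal A) e) := by
  constructor
  · intro i hi
    rw [← QP_sub (A := A)]
    apply XT_of_extMod
    rw [QP_sub]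
    refine (hG.2 i).2 (ne_of_lt (lt_of_lt_of_le ?_ he))
    exact_mod_cast hi
  · apply XT_of_extMod
    by_cases h : (e : WithBot (WithTop ℕ)) = ringKrullDim A
    · obtain ⟨E⟩ := (hG.2 e).1 h
      refine QP_equiv E.symm ?_
      intro x y
      obtain ⟨x, rfl⟩ := Ideal.Quotient.mk_surjective x
      obtain ⟨y, rfl⟩ := Ideal.Quotient.mk_surjective y
      by_cases hx : x ∈ IsLocalRing.maximalIdeal A
      · refine ⟨(1, 0), Or.inl ?_, ?_⟩
        · simp
        · simpa using Ideal.Quotient.eq_zero_iff_mem.2 hx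
      · refine ⟨(y, -x), Or.inr ?_, ?_⟩
        · simpa using hx
        · rw [Algebra.smul_def, Algebra.smul_def, Ideal.Quotient.algebraMap_eq, ← map_mul, ← map_mul, ← map_add]
          rw [show (y, -x).1 * x + (y, -x).2 * y = 0 by simp; ring, map_zero]
    · have := (hG.2 e).2 h
      intro x y
      exact ⟨(1, 0), by simp, Subsingleton.elim _ _⟩

/-- no socle. -/
lemma soc_of_XT (m : Ideal A) (h : Subsingleton (XT A (A ⧸ m) 0)) (x : A)
    (hx : ∀ a ∈ m, a * x = 0) : x = 0 := by
  let g : (A ⧸ m) →ₗ[A] A := m.liftQ (LinearMap.toSpanSingleton A A x) (by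
    intro a ha; simpa using hx a ha)
  have h1 : ModuleCat.ofHom g = 0 := by
    apply Abelian.Ext.addEquiv₀.symm.injective
    exact Subsingleton.elim (α := XT A (A ⧸ m) 0) _ _
  have h2 : g (Submodule.Quotient.mk 1) = 0 := congrArg (fun q => q.hom (Submodule.Quotient.mk 1)) h1
  have h3 : g (Submodule.Quotient.mk 1) = (1 : A) • x := rfl
  rw [h3, one_smul] at h2
  exact h2

end ExtComp
end GP


namespace GP

section Koszul
variable {n : ℕ} {A : Type} [CommRing A]

/-- support in a fixed cardinality -/
def Sup (q : ℕ) (f : Finset (Fin n) → A) : Prop := ∀ S, S.card ≠ q → f S = 0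

lemma Sup.Cv {q : ℕ} {f : Finset (Fin n) → A} (h : Sup (q + 1) f) (v) : Sup q (Cv v f) := by
  intro S hS
  rw [Cv_apply]
  split_ifs with hv
  · rfl
  · rw [h, mul_zero]
    rw [Finset.card_insert_of_notMem hv]; omega

lemma Sup.Ev {q : ℕ} {f : Finset (Fin n) → A} (h : Sup q f) (v) : Sup (q + 1) (Ev v f) := by
  intro S hS
  rw [Ev_apply]
  split_ifs with hv
  · rw [h, mul_zero]
    have := Finset.card_erase_add_one hv
    omega
  · rfl

lemma Sup.Dy {q : ℕ} {f : Finset (Fin n) → A} (h : Sup (q + 1) f) (y : Fin n → A) : Sup q (Dy y f) := by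
  intro S hS
  rw [Dy_apply]
  exact Finset.sum_eq_zero fun i _ => by rw [h.Cv i S hS, mul_zero]

lemma Sup.dy {q : ℕ} {f : Finset (Fin n) → A} (h : Sup q f) (y : Fin n → A) : Sup (q + 1) (dy y f) := by
  intro S hS
  rw [dy_apply]
  exact Finset.sum_eq_zero fun i _ => by rw [h.Ev i S hS, mul_zero]

/-- Koszul module -/
abbrev KF (n : ℕ) (A : Type) (q : ℕ) : Type := {S : Finset (Fin n) // S.card = q} → A

/-- extension by zero -/
def kext (q : ℕ) : KF n A q →ₗ[A] (Finset (Fin n) → A) where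
  toFun x S := if h : S.card = q then x ⟨S, h⟩ else 0
  map_add' x y := by ext S; simp only [Pi.add_apply]; split_ifs <;> simp
  map_smul' a x := by ext S; simp only [Pi.smul_apply, RingHom.id_apply]; split_ifs <;> simp

/-- restriction -/
def kres (q : ℕ) : (Finset (Fin n) → A) →ₗ[A] KF n A q where
  toFun f S := f S.1
  map_add' _ _ := rfl
  map_smul' _ _ := rfl

lemma kext_sup (q : ℕ) (x : KF n A q) : Sup q (kext q x) := by
  intro S hS; simp [kext, hS]

lemma kext_kres (q : ℕ) (f : Finset (Fin n) → A) (h : Sup q f) : kext q (kres q f) = f := by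
  ext S
  by_cases hS : S.card = q
  · simp [kext, kres, hS]
  · rw [h S hS]; simp [kext, hS]

lemma kres_kext (q : ℕ) (x : KF n A q) : kres q (kext q x) = x := by
  ext S
  simp [kext, kres, S.2]

/-- Koszul differential -/
def kd (y : Fin n → A) (q : ℕ) : KF n A (q + 1) →ₗ[A] KF n A q :=
  (kres q).comp ((Dy y).comp (kext (q + 1)))

lemma kext_kd (y : Fin n → A) (q : ℕ) (x : KF n A (q + 1)) :
    kext q (kd y q x) = Dy y (kext (q + 1) x) :=
  kext_kres _ _ ((kext_sup _ _).Dy y)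

lemma kd_kd (y : Fin n → A) (q : ℕ) (x) : kd y q (kd y (q + 1) x) = 0 := by
  change kres q (Dy y (kext (q + 1) (kd y (q + 1) x))) = 0
  rw [kext_kd, Dy_Dy, map_zero]

lemma kd_hom (y : Fin n → A) (q : ℕ) (x : KF n A (q + 1)) (hx : kd y q x = 0) (a : A)
    (ha : a ∈ Ideal.span (Set.range y)) : a • x ∈ LinearMap.range (kd y (q + 1)) := by
  refine Submodule.span_induction (p := fun a _ => a • x ∈ LinearMap.range (kd y (q + 1))) ?_ ?_ ?_ ?_ ha
  · rintro _ ⟨v, rfl⟩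
    refine ⟨kres (q + 1 + 1) (Ev v (kext _ x)), ?_⟩
    have h1 : Dy y (kext (q + 1) x) = 0 := by rw [← kext_kd, hx, map_zero]
    have h2 := Dy_Ev y v (kext (q + 1) x)
    rw [h1, map_zero, add_zero] at h2
    change kres (q + 1) (Dy y (kext _ (kres (q + 1 + 1) (Ev v (kext _ x))))) = _
    rw [kext_kres _ _ ((kext_sup _ _).Ev v), h2, map_smul, kres_kext]
  · simp
  · intro a b _ _ h1 h2
    rw [add_smul]; exact Submodule.add_mem _ h1 h2
  · intro a b _ h
    rw [smul_eq_mul, mul_smul]; exact Submodule.smul_mem _ _ h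

lemma kd_zero_apply (y : Fin n → A) (x : KF n A 1) (S) : kd y 0 x S =
    ∑ i, y i * x ⟨{i}, by simp⟩ := by
  obtain ⟨S, hS⟩ := S
  rw [Finset.card_eq_zero] at hS
  subst hS
  change Dy y (kext 1 x) ∅ = _
  rw [Dy_apply]
  refine Finset.sum_congr rfl fun i _ => ?_
  simp [Cv_apply, kext, sg]

lemma kC0 (y : Fin n → A) :
    Nonempty ((A ⧸ Ideal.span (Set.range y)) ≃ₗ[A] (KF n A 0 ⧸ LinearMap.range (kd y 0))) := by
  let g : KF n A 0 →ₗ[A] (A ⧸ Ideal.span (Set.range y)) :=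
    (Submodule.mkQ (Ideal.span (Set.range y))).comp (LinearMap.proj ⟨∅, rfl⟩)
  have hg : Function.Surjective g := by
    refine (Submodule.mkQ_surjective _).comp ?_
    intro a; exact ⟨fun _ => a, rfl⟩
  have hk : LinearMap.ker g = LinearMap.range (kd y 0) := by
    ext x
    have : x ∈ LinearMap.ker g ↔ x ⟨∅, rfl⟩ ∈ Ideal.span (Set.range y) := by
      rw [LinearMap.mem_ker]
      exact Submodule.Quotient.mk_eq_zero _
    rw [this]
    constructor
    · intro h
      rw [Ideal.mem_span_range_iff_exists_fun] at h
      obtain ⟨c, hc⟩ := h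
      refine ⟨fun S => ∑ i, if S.1 = {i} then c i else 0, ?_⟩
      ext S
      rw [kd_zero_apply]
      obtain ⟨S, hS⟩ := S
      have hS' := hS
      rw [Finset.card_eq_zero] at hS'
      subst hS'
      rw [← hc]
      refine Finset.sum_congr rfl fun i _ => ?_
      simp [mul_comm]
    · rintro ⟨z, rfl⟩
      rw [kd_zero_apply]
      exact Ideal.sum_mem _ fun i _ => Ideal.mul_mem_right _ _ (Ideal.subset_span ⟨i, rfl⟩)
  exact ⟨((Submodule.quotEquivOfEq _ _ hk.symm).trans (g.quotKerEquivOfSurjective hg)).symm⟩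

lemma pr_single (f : Finset (Fin n) → A) (S) : pr f (Pi.single S 1) = f S := by
  classical
  simp [pr, Pi.single_apply]

lemma kos_main [IsNoetherianRing A] (m : Ideal A) [hm : m.IsMaximal] (y : Fin n → A)
    (hy : m = Ideal.span (Set.range y)) (e : ℕ)
    (hK : ∀ i < e, Subsingleton (XT A (A ⧸ m) i)) (s : Set (A × A))
    (j : ℕ) (hj : j + 1 ≤ e) (hQ : QP s (XT A (A ⧸ m) (j + 1)))
    (f f' : Finset (Fin n) → A) (hf : Sup (j + 1) f) (hf' : Sup (j + 1) f')
    (hf0 : dy y f = 0) (hf0' : dy y f' = 0) :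
    ∃ p ∈ s, ∃ ψ : Finset (Fin n) → A, p.1 • f + p.2 • f' = dy y ψ := by
  classical
  let Φ : (Finset (Fin n) → A) → (KF n A (j + 1) →ₗ[A] A) := fun f =>
    { toFun := fun x => pr f (kext _ x)
      map_add' := fun x x' => by simp [pr, mul_add, Finset.sum_add_distrib]
      map_smul' := fun a x => by rw [map_smul, pr_smul_right]; rfl }
  have hΦ : ∀ f, dy y f = 0 → ∀ x, Φ f (kd y (j + 1) x) = 0 := by
    intro f hf x
    change pr f (kext _ (kd y (j + 1) x)) = 0
    rw [kext_kd, pr_Dy, hf]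
    simp [pr]
  obtain ⟨E⟩ := kC0 y
  obtain ⟨p, hp, ψ, hψ⟩ := cx_main m (KF n A) (kd y) (kd_kd y)
    (fun q x hx a ha => kd_hom y q x hx a (hy ▸ ha)) e hK s
    ((Submodule.quotEquivOfEq _ _ hy).trans E)
    (soc_of_XT m (hK 0 (by omega))) j hj hQ (Φ f) (Φ f') (hΦ f hf0) (hΦ f' hf0')
  refine ⟨p, hp, fun S => if h : S.card = j then ψ (Pi.single ⟨S, h⟩ 1) else 0, ?_⟩
  set ψ' : Finset (Fin n) → A := fun S => if h : S.card = j then ψ (Pi.single ⟨S, h⟩ 1) else 0 with hψ'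
  have hs : Sup j ψ' := by intro S hS; simp [hψ', hS]
  have hpr : ∀ x, ψ x = pr ψ' (kext j x) := by
    intro x
    have hx : x = ∑ S, x S • (Pi.single S (1 : A) : KF n A j) := by
      ext S; simp [Finset.sum_apply, Pi.single_apply]
    conv_lhs => rw [hx, map_sum]
    unfold pr
    rw [← Finset.sum_filter_of_ne (p := fun S : Finset (Fin n) => S.card = j),
      Finset.sum_subtype (p := fun S : Finset (Fin n) => S.card = j) _ (by simp)]
    · refine Finset.sum_congr rfl fun S _ => ?_
      rw [map_smul, smul_eq_mul, mul_comm]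
      simp [hψ', kext, S.2]
    · intro S _ h
      by_contra hS
      exact h (by rw [hs S hS, zero_mul])
  ext S
  by_cases hS : S.card = j + 1
  · have h1 := hψ (kres (j + 1) (Pi.single S 1))
    have h2 : kext (j + 1) (kres (j + 1) (Pi.single S (1 : A))) = Pi.single S 1 := by
      apply kext_kres
      intro T hT
      rw [Pi.single_apply, if_neg]
      rintro rfl; exact hT hS
    change p.1 * pr f _ + p.2 * pr f' _ = _ at h1
    rw [hpr, kext_kd, h2, pr_Dy, pr_single, pr_single, pr_single] at h1
    exact h1
  · rw [hs.dy y S hS]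
    simp [hf S hS, hf' S hS]

end Koszul
end GP


namespace GP

section SRprime
variable (k : Type) [Field k] {n : ℕ} (Δ : SC n)

/-- membership in the link -/
def Lk (σ F : Finset (Fin n)) : Prop := Disjoint F σ ∧ F ∪ σ ∈ Δ.faces

/-- evaluation killing variables outside `σ` -/
noncomputable def th (σ : Finset (Fin n)) : MvPolynomial (Fin n) k →ₐ[k] MvPolynomial (Fin n) k :=
  MvPolynomial.aeval (fun i => if i ∈ σ then MvPolynomial.X i else 0)

lemma th_X (σ : Finset (Fin n)) (i) : th k σ (MvPolynomial.X i) = if i ∈ σ then MvPolynomial.X i else 0 := by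
  simp [th]

lemma th_sr {σ : Finset (Fin n)} (hσ : σ ∈ Δ.faces) (p) (hp : p ∈ srIdeal k Δ) : th k σ p = 0 := by
  have : srIdeal k Δ ≤ RingHom.ker (th k σ) := by
    unfold srIdeal
    rw [Ideal.span_le]
    rintro _ ⟨τ, hτ, rfl⟩
    rw [SetLike.mem_coe, RingHom.mem_ker, map_prod]
    have : ∃ i ∈ τ, i ∉ σ := by
      by_contra h
      push Not at h
      exact hτ (Δ.down_closed hσ h)
    obtain ⟨i, hi, hi'⟩ := this
    refine Finset.prod_eq_zero hi ?_
    simp [th_X, hi']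
  exact this hp

/-- the induced map -/
noncomputable def thq {σ : Finset (Fin n)} (hσ : σ ∈ Δ.faces) : SRRing k Δ →+* MvPolynomial (Fin n) k :=
  Ideal.Quotient.lift (srIdeal k Δ) (th k σ).toRingHom (fun p hp => th_sr k Δ hσ p hp)

/-- the face prime -/
noncomputable def Pf {σ : Finset (Fin n)} (hσ : σ ∈ Δ.faces) : Ideal (SRRing k Δ) := RingHom.ker (thq k Δ hσ)

instance Pf_prime {σ : Finset (Fin n)} (hσ : σ ∈ Δ.faces) : (Pf k Δ hσ).IsPrime := RingHom.ker_isPrime _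

lemma ker_th (σ : Finset (Fin n)) (p : MvPolynomial (Fin n) k) :
    th k σ p = 0 ↔ p ∈ Ideal.span (MvPolynomial.X '' {i | i ∉ σ} : Set (MvPolynomial (Fin n) k)) := by
  set I := Ideal.span (MvPolynomial.X '' {i | i ∉ σ} : Set (MvPolynomial (Fin n) k)) with hI
  constructor
  · intro h
    have h1 : ((Ideal.Quotient.mkₐ k I).comp (th k σ)) = Ideal.Quotient.mkₐ k I := by
      apply MvPolynomial.algHom_ext
      intro i
      rw [AlgHom.comp_apply, th_X]
      split_ifs with hi
      · rfl
      · rw [map_zero]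
        symm
        exact Ideal.Quotient.eq_zero_iff_mem.2 (Ideal.subset_span ⟨i, hi, rfl⟩)
    have h2 := DFunLike.congr_fun h1 p
    rw [AlgHom.comp_apply, h, map_zero] at h2
    exact Ideal.Quotient.eq_zero_iff_mem.1 h2.symm
  · intro h
    have : I ≤ RingHom.ker (th k σ) := by
      rw [hI, Ideal.span_le]
      rintro _ ⟨i, hi, rfl⟩
      rw [SetLike.mem_coe, RingHom.mem_ker, th_X, if_neg hi]
    exact this h

lemma Pf_comap {σ : Finset (Fin n)} (hσ : σ ∈ Δ.faces) (p) :
    Ideal.Quotient.mk _ p ∈ Pf k Δ hσ ↔ th k σ p = 0 := Iff.rfl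

lemma Pf_homog {σ : Finset (Fin n)} (hσ : σ ∈ Δ.faces) :
    IsHomogIdeal k ((Pf k Δ hσ).comap (Ideal.Quotient.mk (srIdeal k Δ))) := by
  intro p hp d
  rw [Ideal.mem_comap, Pf_comap, ker_th, MvPolynomial.mem_ideal_span_X_image] at hp ⊢
  intro m hm
  apply hp m
  rw [MvPolynomial.mem_support_iff, MvPolynomial.coeff_homogeneousComponent] at hm
  rw [MvPolynomial.mem_support_iff]
  intro h
  apply hm
  simp [h]

lemma Pf_ne {σ : Finset (Fin n)} (hσ : σ ∈ Δ.faces) (hne : σ.Nonempty) :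
    Pf k Δ hσ ≠ quotMax k (srIdeal k Δ) := by
  obtain ⟨i, hi⟩ := hne
  intro h
  have : Ideal.Quotient.mk (srIdeal k Δ) (MvPolynomial.X i) ∈ Pf k Δ hσ := by
    rw [h]; exact Ideal.subset_span ⟨i, rfl⟩
  rw [Pf_comap, th_X, if_pos hi] at this
  exact MvPolynomial.X_ne_zero i this

lemma Pf_eq {σ : Finset (Fin n)} (hσ : σ ∈ Δ.faces) :
    Pf k Δ hσ = Ideal.span (Set.range fun i => if i ∈ σ then (0 : SRRing k Δ) else Ideal.Quotient.mk _ (MvPolynomial.X i)) := by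
  apply le_antisymm
  · intro x hx
    obtain ⟨p, rfl⟩ := Ideal.Quotient.mk_surjective x
    rw [Pf_comap, ker_th] at hx
    have := Ideal.mem_map_of_mem (Ideal.Quotient.mk (srIdeal k Δ)) hx
    rw [Ideal.map_span] at this
    refine Ideal.span_mono ?_ this
    rintro _ ⟨_, ⟨i, hi, rfl⟩, rfl⟩
    exact ⟨i, if_neg hi⟩
  · rw [Ideal.span_le]
    rintro _ ⟨i, rfl⟩
    dsimp only
    split_ifs with hi
    · exact Ideal.zero_mem _
    · rw [SetLike.mem_coe, Pf_comap, th_X, if_neg hi]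

lemma Pf_height : ∀ (c : ℕ) {σ τ : Finset (Fin n)} (hσ : σ ∈ Δ.faces) (hτ : τ ∈ Δ.faces), σ ⊆ τ →
    (τ \ σ).card = c → (c : ℕ∞) ≤ (Pf k Δ hσ).height := by
  intro c
  induction c with
  | zero => intros; simp
  | succ c ih =>
    intro σ τ hσ hτ hst hc
    obtain ⟨v, hv⟩ : (τ \ σ).Nonempty := by rw [← Finset.card_pos]; omega
    rw [Finset.mem_sdiff] at hv
    have hins : insert v σ ⊆ τ := Finset.insert_subset hv.1 hst
    have hσ' := Δ.down_closed hτ hins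
    have h1 := ih hσ' hτ hins (by
      rw [Finset.sdiff_insert, Finset.card_erase_of_mem (by simp [hv])]; omega)
    have hlt : Pf k Δ hσ' < Pf k Δ hσ := by
      rw [lt_iff_le_and_ne]
      constructor
      · intro x hx
        obtain ⟨p, rfl⟩ := Ideal.Quotient.mk_surjective x
        rw [Pf_comap, ker_th] at hx ⊢
        refine Ideal.span_mono (Set.image_mono ?_) hx
        intro i hi hi'
        exact hi (Finset.mem_insert_of_mem hi')
      · intro h
        have : Ideal.Quotient.mk (srIdeal k Δ) (MvPolynomial.X v) ∈ Pf k Δ hσ := by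
          rw [Pf_comap, th_X, if_neg hv.2]
        rw [← h, Pf_comap, th_X, if_pos (Finset.mem_insert_self _ _)] at this
        exact MvPolynomial.X_ne_zero v this
    have h2 := Ideal.height_add_one_le_of_lt_of_isPrime hlt
    refine le_trans ?_ h2
    push_cast
    gcongr

/-- the local ring -/
abbrev LR {σ : Finset (Fin n)} (hσ : σ ∈ Δ.faces) : Type := Localization.AtPrime (Pf k Δ hσ)

/-- the generators of the maximal ideal -/
noncomputable def yv {σ : Finset (Fin n)} (hσ : σ ∈ Δ.faces) (i : Fin n) : LR k Δ hσ :=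
  algebraMap (SRRing k Δ) _ (if i ∈ σ then (0 : SRRing k Δ) else Ideal.Quotient.mk _ (MvPolynomial.X i))

lemma yv_max {σ : Finset (Fin n)} (hσ : σ ∈ Δ.faces) :
    IsLocalRing.maximalIdeal (LR k Δ hσ) = Ideal.span (Set.range (yv k Δ hσ)) := by
  rw [← Localization.AtPrime.map_eq_maximalIdeal]
  refine (congrArg (Ideal.map (algebraMap (SRRing k Δ) (LR k Δ hσ))) (Pf_eq k Δ hσ)).trans ?_
  rw [Ideal.map_span, ← Set.range_comp]
  rfl

lemma LR_dim {σ : Finset (Fin n)} (hσ : σ ∈ Δ.faces) (F : Finset (Fin n)) (hF : Lk Δ σ F) :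
    (F.card : WithBot (WithTop ℕ)) ≤ ringKrullDim (LR k Δ hσ) := by
  rw [IsLocalization.AtPrime.ringKrullDim_eq_height (Pf k Δ hσ) (LR k Δ hσ)]
  have := Pf_height k Δ F.card hσ hF.2 Finset.subset_union_right (by
    rw [Finset.union_sdiff_right, Finset.sdiff_eq_self_of_disjoint hF.1])
  exact WithBot.coe_le_coe.2 this

lemma yv_prod {σ : Finset (Fin n)} (hσ : σ ∈ Δ.faces) (F : Finset (Fin n)) (hF : ¬ Lk Δ σ F) :
    ∏ i ∈ F, yv k Δ hσ i = 0 := by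
  by_cases hd : Disjoint F σ
  · have h1 : F ∪ σ ∉ Δ.faces := fun h => hF ⟨hd, h⟩
    have h2 : (∏ i ∈ F, yv k Δ hσ i) * ∏ i ∈ σ, algebraMap (SRRing k Δ) (LR k Δ hσ) (Ideal.Quotient.mk _ (MvPolynomial.X i)) = 0 := by
      have e1 : ∏ i ∈ F, yv k Δ hσ i = ∏ i ∈ F, algebraMap (SRRing k Δ) (LR k Δ hσ) (Ideal.Quotient.mk _ (MvPolynomial.X i)) := by
        refine Finset.prod_congr rfl fun i hi => ?_
        rw [yv, if_neg (Finset.disjoint_left.1 hd hi)]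
      rw [e1, ← Finset.prod_union hd, ← map_prod, ← map_prod]
      rw [show Ideal.Quotient.mk (srIdeal k Δ) (∏ i ∈ F ∪ σ, MvPolynomial.X i) = 0 from
        Ideal.Quotient.eq_zero_iff_mem.2 (Ideal.subset_span ⟨_, h1, rfl⟩), map_zero]
    have h3 : IsUnit (∏ i ∈ σ, algebraMap (SRRing k Δ) (LR k Δ hσ) (Ideal.Quotient.mk _ (MvPolynomial.X i))) := by
      have hmem : (∏ i ∈ σ, Ideal.Quotient.mk (srIdeal k Δ) (MvPolynomial.X i)) ∈ (Pf k Δ hσ).primeCompl := by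
        rw [Ideal.mem_primeCompl_iff, ← map_prod, Pf_comap, map_prod, Finset.prod_eq_zero_iff]
        rintro ⟨i, hi, h⟩
        rw [th_X, if_pos hi] at h
        exact MvPolynomial.X_ne_zero i h
      rw [← map_prod]
      exact IsLocalization.map_units (LR k Δ hσ) (⟨_, hmem⟩ : (Pf k Δ hσ).primeCompl)
    exact (h3.mul_left_eq_zero).1 h2
  · rw [Finset.not_disjoint_iff] at hd
    obtain ⟨i, hi, hi'⟩ := hd
    refine Finset.prod_eq_zero hi ?_
    rw [yv, if_pos hi', map_zero]

end SRprime
end GP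


namespace GP

section Detect
variable (k : Type) [Field k] {n : ℕ} (Δ : SC n)

lemma Lk.mono {Δ : SC n} {σ F G : Finset (Fin n)} (h : Lk Δ σ F) (hG : G ⊆ F) : Lk Δ σ G :=
  ⟨h.1.mono_left hG, Δ.down_closed h.2 (Finset.union_subset_union hG le_rfl)⟩

/-- the coefficient field -/
abbrev KK (n : ℕ) : Type := FractionRing (MvPolynomial (Fin n) k)

/-- the power series ring -/
abbrev PS (n : ℕ) : Type := MvPowerSeries (Fin n) (KK k n)

/-- indicator exponent -/
noncomputable def ind (F : Finset (Fin n)) : Fin n →₀ ℕ := Finsupp.indicator F (fun _ _ => 1)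

lemma ind_apply (F : Finset (Fin n)) (i) : ind F i = if i ∈ F then 1 else 0 := by
  simp [ind, Finsupp.indicator_apply]

lemma le_ind (F : Finset (Fin n)) (a : Fin n →₀ ℕ) (h : a ≤ ind F) : ∃ G ⊆ F, a = ind G := by
  refine ⟨a.support, ?_, ?_⟩
  · intro i hi
    by_contra hc
    have := h i
    rw [ind_apply, if_neg hc] at this
    rw [Finsupp.mem_support_iff] at hi
    omega
  · ext i
    rw [ind_apply]
    have := h i
    rw [ind_apply] at this
    split_ifs with h1
    · rw [Finsupp.mem_support_iff] at h1
      split_ifs at this <;> omega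
    · simpa using h1

lemma ind_empty : ind (∅ : Finset (Fin n)) = 0 := by ext; simp [ind_apply]

/-- the ideal of series vanishing on link faces -/
noncomputable def Jd (σ : Finset (Fin n)) : Ideal (PS k n) where
  carrier := {p | ∀ F, Lk Δ σ F → MvPowerSeries.coeff (ind F) p = 0}
  zero_mem' := fun F _ => by simp
  add_mem' := fun {a b} ha hb F hF => by rw [map_add, ha F hF, hb F hF, add_zero]
  smul_mem' := fun c x hx F hF => by
    classical
    rw [smul_eq_mul, MvPowerSeries.coeff_mul]
    refine Finset.sum_eq_zero fun p hp => ?_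
    rw [Finset.HasAntidiagonal.mem_antidiagonal] at hp
    obtain ⟨G, hG, h⟩ := le_ind F p.2 (by rw [← hp]; exact le_add_self)
    rw [h, hx G (hF.mono hG), mul_zero]

/-- the map to power series -/
noncomputable def g0 (σ : Finset (Fin n)) : MvPolynomial (Fin n) k →+* PS k n :=
  MvPolynomial.eval₂Hom ((MvPowerSeries.C).comp (algebraMap k (KK k n)))
    (fun i => if i ∈ σ then MvPowerSeries.C (algebraMap (MvPolynomial (Fin n) k) (KK k n) (MvPolynomial.X i)) else MvPowerSeries.X i)

lemma g0_X (σ : Finset (Fin n)) (i) : g0 k σ (MvPolynomial.X i) = if i ∈ σ then MvPowerSeries.C (algebraMap (MvPolynomial (Fin n) k) (KK k n) (MvPolynomial.X i)) else MvPowerSeries.X i := by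
  simp [g0]

lemma g0_C (σ : Finset (Fin n)) (c : k) : g0 k σ (MvPolynomial.C c) = MvPowerSeries.C (algebraMap k (KK k n) c) := by
  simp [g0]

lemma g0_const (σ : Finset (Fin n)) (p) :
    MvPowerSeries.constantCoeff (g0 k σ p) = algebraMap (MvPolynomial (Fin n) k) (KK k n) (th k σ p) := by
  have : (MvPowerSeries.constantCoeff).comp (g0 k σ) =
      (algebraMap (MvPolynomial (Fin n) k) (KK k n)).comp (th k σ).toRingHom := by
    apply MvPolynomial.ringHom_ext
    · intro c
      simp only [RingHom.comp_apply]
      rw [g0_C]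
      have : (th k σ).toRingHom (MvPolynomial.C c) = MvPolynomial.C c := (th k σ).commutes c
      rw [this, MvPowerSeries.constantCoeff_C]
      rw [IsScalarTower.algebraMap_apply k (MvPolynomial (Fin n) k) (KK k n)]
      rfl
    · intro i
      simp only [RingHom.comp_apply]
      rw [g0_X]
      have : (th k σ).toRingHom (MvPolynomial.X i) = _ := th_X k σ i
      rw [this]
      split_ifs <;> simp
  exact RingHom.congr_fun this p

lemma coeff_prodX (F G : Finset (Fin n)) (p : PS k n) (h : ¬ G ⊆ F) :
    MvPowerSeries.coeff (ind F) ((∏ i ∈ G, MvPowerSeries.X i) * p) = 0 := by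
  classical
  rw [Finset.not_subset] at h
  obtain ⟨i, hi, hi'⟩ := h
  rw [← Finset.mul_prod_erase G _ hi, mul_assoc, MvPowerSeries.X_def, MvPowerSeries.coeff_monomial_mul]
  rw [if_neg]
  intro hle
  have := hle i
  simp [ind_apply, hi'] at this

lemma g0_sr {σ : Finset (Fin n)} (p) (hp : p ∈ srIdeal k Δ) : g0 k σ p ∈ Jd k Δ σ := by
  classical
  have : srIdeal k Δ ≤ (Jd k Δ σ).comap (g0 k σ) := by
    unfold srIdeal
    rw [Ideal.span_le]
    rintro _ ⟨τ, hτ, rfl⟩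
    rw [SetLike.mem_coe, Ideal.mem_comap, map_prod]
    intro F hF
    rw [← Finset.prod_sdiff (Finset.inter_subset_left : τ ∩ σ ⊆ τ)]
    have e : ∏ i ∈ τ \ (τ ∩ σ), g0 k σ (MvPolynomial.X i) = ∏ i ∈ τ \ (τ ∩ σ), MvPowerSeries.X i := by
      refine Finset.prod_congr rfl fun i hi => ?_
      rw [g0_X, if_neg]
      intro h
      simp at hi
      exact hi.2 h
    rw [e]
    apply coeff_prodX
    intro hs
    apply hτ
    apply Δ.down_closed hF.2
    intro i hi
    by_cases h : i ∈ σ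
    · simp [h]
    · exact Finset.mem_union_left _ (hs (by simp [hi, h]))
  exact this hp

/-- the map from the SR ring -/
noncomputable def g1 (σ : Finset (Fin n)) : SRRing k Δ →+* PS k n ⧸ Jd k Δ σ :=
  Ideal.Quotient.lift (srIdeal k Δ) ((Ideal.Quotient.mk _).comp (g0 k σ))
    (fun p hp => Ideal.Quotient.eq_zero_iff_mem.2 (g0_sr k Δ p hp))

/-- the map from the local ring -/
noncomputable def g2 {σ : Finset (Fin n)} (hσ : σ ∈ Δ.faces) : LR k Δ hσ →+* PS k n ⧸ Jd k Δ σ :=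
  IsLocalization.lift (M := (Pf k Δ hσ).primeCompl) (g := g1 k Δ σ) (by
    rintro ⟨x, hx⟩
    obtain ⟨p, rfl⟩ := Ideal.Quotient.mk_surjective x
    rw [Ideal.mem_primeCompl_iff, Pf_comap] at hx
    change IsUnit (Ideal.Quotient.mk (Jd k Δ σ) (g0 k σ p))
    apply IsUnit.map
    rw [MvPowerSeries.isUnit_iff_constantCoeff, g0_const, isUnit_iff_ne_zero]
    intro h
    exact hx ((IsFractionRing.injective (MvPolynomial (Fin n) k) (KK k n)) (by rw [h, map_zero])))

lemma g2_alg {σ : Finset (Fin n)} (hσ : σ ∈ Δ.faces) (p) :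
    g2 k Δ hσ (algebraMap (SRRing k Δ) _ (Ideal.Quotient.mk _ p)) = Ideal.Quotient.mk _ (g0 k σ p) := by
  unfold g2
  rw [IsLocalization.lift_eq]
  rfl

open Classical in
/-- coefficient on the quotient -/
noncomputable def cf (σ F : Finset (Fin n)) (a : PS k n ⧸ Jd k Δ σ) : KK k n :=
  if Lk Δ σ F then MvPowerSeries.coeff (ind F) (Quotient.out a) else 0

lemma cf_mk {σ F : Finset (Fin n)} (hF : Lk Δ σ F) (p : PS k n) :
    cf k Δ σ F (Ideal.Quotient.mk _ p) = MvPowerSeries.coeff (ind F) p := by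
  rw [cf, if_pos hF]
  have : Quotient.out (Ideal.Quotient.mk (Jd k Δ σ) p) - p ∈ Jd k Δ σ := by
    rw [← Ideal.Quotient.eq]
    exact Quotient.out_eq _
  have := this F hF
  rwa [map_sub, sub_eq_zero] at this

/-- Detection data for a link. -/
structure Det (k : Type) [Field k] {n : ℕ} (Δ : SC n) (σ : Finset (Fin n)) (A : Type) [CommRing A]
    [IsLocalRing A] where
  y : Fin n → A
  hy : IsLocalRing.maximalIdeal A = Ideal.span (Set.range y)
  K : Type
  fK : Field K
  ι : k →+* A
  κ : k →+* K
  cf : Finset (Fin n) → A → K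
  cf_add : ∀ F, Lk Δ σ F → ∀ a b, cf F (a + b) = cf F a + cf F b
  cf_ι : ∀ F, Lk Δ σ F → ∀ c a, cf F (ι c * a) = κ c * cf F a
  cf_y : ∀ F, Lk Δ σ F → ∀ i a, cf F (y i * a) = if i ∈ F then cf (F.erase i) a else 0
  cf_unit : ∀ a, a ∉ IsLocalRing.maximalIdeal A → cf ∅ a ≠ 0
  prod : ∀ F, ¬ Lk Δ σ F → ∏ i ∈ F, y i = 0

/-- The detection data of the local rings. -/
noncomputable def detLR {σ : Finset (Fin n)} (hσ : σ ∈ Δ.faces) : Det k Δ σ (LR k Δ hσ) where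
  y := yv k Δ hσ
  hy := yv_max k Δ hσ
  K := KK k n
  fK := inferInstance
  ι := (algebraMap (SRRing k Δ) (LR k Δ hσ)).comp ((Ideal.Quotient.mk _).comp MvPolynomial.C)
  κ := algebraMap k (KK k n)
  cf := fun F a => cf k Δ σ F (g2 k Δ hσ a)
  cf_add := by
    intro F hF a b
    rw [map_add]
    obtain ⟨p, hp⟩ := Ideal.Quotient.mk_surjective (g2 k Δ hσ a)
    obtain ⟨q, hq⟩ := Ideal.Quotient.mk_surjective (g2 k Δ hσ b)
    rw [← hp, ← hq, ← map_add, cf_mk k Δ hF, cf_mk k Δ hF, cf_mk k Δ hF, map_add]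
  cf_ι := by
    intro F hF c a
    rw [map_mul]
    obtain ⟨p, hp⟩ := Ideal.Quotient.mk_surjective (g2 k Δ hσ a)
    simp only [RingHom.comp_apply]
    rw [g2_alg, g0_C, ← hp, ← map_mul, cf_mk k Δ hF, cf_mk k Δ hF, MvPowerSeries.coeff_C_mul]
  cf_y := by
    classical
    intro F hF i a
    rw [map_mul]
    obtain ⟨p, hp⟩ := Ideal.Quotient.mk_surjective (g2 k Δ hσ a)
    rw [← hp, yv]
    by_cases hi : i ∈ σ
    · have : i ∉ F := fun h => Finset.disjoint_left.1 hF.1 h hi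
      rw [if_pos hi, if_neg this, map_zero, map_zero, zero_mul, ← map_zero (Ideal.Quotient.mk _), cf_mk k Δ hF, map_zero]
    · rw [if_neg hi, g2_alg, g0_X, if_neg hi, ← map_mul, cf_mk k Δ hF, MvPowerSeries.X_def, MvPowerSeries.coeff_monomial_mul, one_mul]
      have e : Finsupp.single i 1 ≤ ind F ↔ i ∈ F := by
        rw [Finsupp.single_le_iff, ind_apply]
        split_ifs with h <;> simp [h]
      by_cases h : i ∈ F
      · rw [if_pos (e.2 h), if_pos h, cf_mk k Δ (hF.mono (Finset.erase_subset _ _))]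
        congr 1
        congr 1
        ext j
        rw [Finsupp.tsub_apply, ind_apply, ind_apply, Finsupp.single_apply]
        by_cases hj : i = j
        · subst hj; simp [h]
        · have : ¬ j = i := fun h => hj h.symm
          simp [hj, this]
      · rw [if_neg (fun h' => h (e.1 h')), if_neg h]
  cf_unit := by
    intro a ha
    have hu : IsUnit a := by
      by_contra h
      exact ha ((IsLocalRing.mem_maximalIdeal a).2 h)
    have h0 : Lk Δ σ ∅ := ⟨Finset.disjoint_empty_left _, by simpa using hσ⟩
    obtain ⟨b, hb⟩ := (hu.map (g2 k Δ hσ)).exists_right_inv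
    obtain ⟨p, hp⟩ := Ideal.Quotient.mk_surjective (g2 k Δ hσ a)
    obtain ⟨q, rfl⟩ := Ideal.Quotient.mk_surjective b
    rw [← hp, ← map_mul, ← map_one (Ideal.Quotient.mk _), Ideal.Quotient.eq] at hb
    have := hb ∅ h0
    rw [← hp, cf_mk k Δ h0]
    rw [ind_empty, MvPowerSeries.coeff_zero_eq_constantCoeff_apply] at this ⊢
    intro h
    rw [map_sub, map_mul, h, map_one] at this
    simp at this
  prod := yv_prod k Δ hσ

end Detect
end GP


namespace GP

section AO
variable {k : Type} [Field k] {n : ℕ}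

/-- supported on `P` -/
def On {R : Type} [CommRing R] (P : Finset (Fin n) → Prop) (z : Finset (Fin n) → R) : Prop := ∀ S, ¬ P S → z S = 0

lemma dual_ex (P : Finset (Fin n) → Prop) (j : ℕ) (z : Finset (Fin n) → k) (hz : Sup j z)
    (h : ¬ ∃ y, Sup (j + 1) y ∧ On P y ∧ Dy 1 y = z) :
    ∃ c : Finset (Fin n) → k, Sup j c ∧ (∀ F, P F → dy 1 c F = 0) ∧ pr c z ≠ 0 := by
  classical
  let B0 : Submodule k (Finset (Fin n) → k) :=
    { carrier := {y | Sup (j + 1) y ∧ On P y}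
      zero_mem' := ⟨fun _ _ => rfl, fun _ _ => rfl⟩
      add_mem' := fun {a b} ha hb => ⟨fun S hS => by rw [Pi.add_apply, ha.1 S hS, hb.1 S hS, add_zero],
        fun S hS => by rw [Pi.add_apply, ha.2 S hS, hb.2 S hS, add_zero]⟩
      smul_mem' := fun r a ha => ⟨fun S hS => by rw [Pi.smul_apply, ha.1 S hS, smul_zero],
        fun S hS => by rw [Pi.smul_apply, ha.2 S hS, smul_zero]⟩ }
  have hn : z ∉ B0.map (Dy (1 : Fin n → k)) := by
    rintro ⟨y, hy, rfl⟩
    exact h ⟨y, hy.1, hy.2, rfl⟩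
  obtain ⟨ℓ, hℓ, hB⟩ := Submodule.exists_le_ker_of_notMem hn
  let c : Finset (Fin n) → k := fun S => if S.card = j then ℓ (Pi.single S 1) else 0
  have hc : ∀ w, Sup j w → pr c w = ℓ w := by
    intro w hw
    conv_rhs => rw [pi_eq_sum_univ' w, map_sum]
    unfold pr
    refine Finset.sum_congr rfl fun S _ => ?_
    rw [map_smul, smul_eq_mul, mul_comm]
    by_cases hS : S.card = j
    · simp only [c, if_pos hS]
    · rw [hw S hS]; simp
  refine ⟨c, fun S hS => if_neg hS, ?_, by rw [hc z hz]; exact hℓ⟩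
  intro F hF
  by_cases hcard : F.card = j + 1
  · rw [← pr_single (dy 1 c) F, ← pr_Dy]
    have hs : Sup (j + 1) (Pi.single F (1 : k)) := by
      intro S hS
      rw [Pi.single_eq_of_ne]
      rintro rfl; exact hS hcard
    rw [hc _ (hs.Dy _)]
    refine hB ⟨_, ⟨hs, ?_⟩, rfl⟩
    intro S hS
    rw [Pi.single_eq_of_ne]
    rintro rfl; exact hS hF
  · have : Sup j c := fun S hS => if_neg hS
    exact (this.dy 1) F hcard

variable {Δ : SC n} {σ : Finset (Fin n)} {A : Type} [CommRing A] [IsLocalRing A] (D : Det k Δ σ A)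

instance : Field D.K := D.fK

/-- associated Koszul cochain -/
noncomputable def phi (c : Finset (Fin n) → k) : Finset (Fin n) → A := fun S => D.ι (c S) * ∏ i ∈ S, D.y i

lemma map_sg {R R' : Type} [CommRing R] [CommRing R'] (f : R →+* R') (S : Finset (Fin n)) (i) :
    f (sg R S i) = sg R' S i := by simp [sg]

lemma map_dy {R R' : Type} [CommRing R] [CommRing R'] (f : R →+* R') (c : Finset (Fin n) → R) (S) :
    f (dy 1 c S) = dy 1 (fun T => f (c T)) S := by
  rw [dy_apply, dy_apply, map_sum]
  refine Finset.sum_congr rfl fun i _ => ?_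
  rw [Ev_apply, Ev_apply]
  split_ifs <;> simp [map_sg]

lemma map_Dy {R R' : Type} [CommRing R] [CommRing R'] (f : R →+* R') (c : Finset (Fin n) → R) (S) :
    f (Dy 1 c S) = Dy 1 (fun T => f (c T)) S := by
  rw [Dy_apply, Dy_apply, map_sum]
  refine Finset.sum_congr rfl fun i _ => ?_
  rw [Cv_apply, Cv_apply]
  split_ifs <;> simp [map_sg]

lemma map_pr {R R' : Type} [CommRing R] [CommRing R'] (f : R →+* R') (c z : Finset (Fin n) → R) :
    f (pr c z) = pr (fun T => f (c T)) (fun T => f (z T)) := by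
  simp [pr]

lemma phi_dy (c : Finset (Fin n) → k) : dy D.y (phi D c) = phi D (dy 1 c) := by
  funext S
  unfold phi
  rw [dy_apply, map_dy, dy_apply, Finset.sum_mul]
  refine Finset.sum_congr rfl fun i _ => ?_
  rw [Ev_apply, Ev_apply]
  split_ifs with hi
  · rw [← Finset.mul_prod_erase S _ hi, Pi.one_apply]
    ring
  · simp

lemma phi_zero (c : Finset (Fin n) → k) (S) (h : Lk Δ σ S → c S = 0) : phi D c S = 0 := by
  unfold phi
  by_cases hS : Lk Δ σ S
  · rw [h hS]; simp
  · rw [D.prod S hS, mul_zero]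

lemma cf_zero (F) (hF : Lk Δ σ F) : D.cf F 0 = 0 := by
  have := D.cf_add F hF 0 0
  simpa using this

lemma cf_prod (F) (hF : Lk Δ σ F) (a : A) : D.cf F ((∏ i ∈ F, D.y i) * a) = D.cf ∅ a := by
  induction F using Finset.induction_on with
  | empty => simp
  | insert v F hv ih =>
    rw [Finset.prod_insert hv, mul_assoc, D.cf_y _ hF, if_pos (Finset.mem_insert_self _ _), Finset.erase_insert hv]
    exact ih (hF.mono (Finset.subset_insert _ _))

lemma cf_phi (F) (hF : Lk Δ σ F) (c : Finset (Fin n) → k) (a : A) :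
    D.cf F (a * phi D c F) = D.κ (c F) * D.cf ∅ a := by
  unfold phi
  rw [show a * (D.ι (c F) * ∏ i ∈ F, D.y i) = D.ι (c F) * ((∏ i ∈ F, D.y i) * a) by ring, D.cf_ι F hF, cf_prod D F hF]

lemma cf_neg1 (F) (hF : Lk Δ σ F) (q : ℕ) (a : A) : D.cf F ((-1) ^ q * a) = (-1) ^ q * D.cf F a := by
  have := D.cf_ι F hF ((-1) ^ q) a
  simpa using this

lemma cf_sum {T : Type} (s : Finset T) (F) (hF : Lk Δ σ F) (f : T → A) :
    D.cf F (∑ i ∈ s, f i) = ∑ i ∈ s, D.cf F (f i) := by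
  classical
  induction s using Finset.induction_on with
  | empty => simp [cf_zero D F hF]
  | insert a s ha ih => rw [Finset.sum_insert ha, Finset.sum_insert ha, D.cf_add F hF, ih]

lemma cf_neg (F) (hF : Lk Δ σ F) (a : A) : D.cf F (-a) = - D.cf F a := by
  simpa using cf_neg1 D F hF 1 a

lemma cf_dy (F) (hF : Lk Δ σ F) (ψ : Finset (Fin n) → A) :
    D.cf F (dy D.y ψ F) = dy (1 : Fin n → D.K) (fun G => D.cf G (ψ G)) F := by
  rw [dy_apply, dy_apply, cf_sum D _ F hF]
  refine Finset.sum_congr rfl fun i _ => ?_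
  rw [Ev_apply, Ev_apply, D.cf_y F hF]
  split_ifs with hi
  · have := hF.mono (Finset.erase_subset i F)
    unfold sg
    rw [cf_neg1 D _ this, Pi.one_apply, one_mul]
  · simp

lemma pr_kill (P : Finset (Fin n) → Prop) (hP : ∀ S, P S → Lk Δ σ S) (b : Finset (Fin n) → D.K) (z : Finset (Fin n) → k)
    (hz : On P z) (hz0 : Dy 1 z = 0) (w : Finset (Fin n) → D.K) (hw : ∀ F, P F → w F = dy 1 b F) :
    pr w (fun T => D.κ (z T)) = 0 := by
  have h1 : pr w (fun T => D.κ (z T)) = pr (dy 1 b) (fun T => D.κ (z T)) := by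
    unfold pr
    refine Finset.sum_congr rfl fun S _ => ?_
    by_cases hS : P S
    · rw [hw S hS]
    · simp [hz S hS]
  rw [h1, ← pr_Dy]
  have : Dy (1 : Fin n → D.K) (fun T => D.κ (z T)) = 0 := by
    funext S
    rw [← map_Dy, hz0]; simp
  rw [this]
  simp [pr]

lemma T1 [IsNoetherianRing A] (e : ℕ) (hK : ∀ i < e, Subsingleton (XT A (A ⧸ IsLocalRing.maximalIdeal A) i))
    (s : Set (A × A)) (j : ℕ) (hj : j + 1 ≤ e) (hQ : QP s (XT A (A ⧸ IsLocalRing.maximalIdeal A) (j + 1)))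
    (c c' : Finset (Fin n) → k) (hc : Sup (j + 1) c) (hc' : Sup (j + 1) c')
    (h0 : ∀ F, Lk Δ σ F → dy 1 c F = 0) (h0' : ∀ F, Lk Δ σ F → dy 1 c' F = 0) :
    ∃ p ∈ s, ∀ z, On (Lk Δ σ) z → Dy 1 z = 0 →
      D.κ (pr c z) * D.cf ∅ p.1 + D.κ (pr c' z) * D.cf ∅ p.2 = 0 := by
  obtain ⟨p, hp, ψ, hψ⟩ := kos_main (IsLocalRing.maximalIdeal A) D.y D.hy e hK s j hj hQ (phi D c) (phi D c')
    (fun S hS => by simp [phi, hc S hS]) (fun S hS => by simp [phi, hc' S hS])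
    (by rw [phi_dy]; funext S; exact phi_zero D _ S (h0 S))
    (by rw [phi_dy]; funext S; exact phi_zero D _ S (h0' S))
  refine ⟨p, hp, fun z hz hz0 => ?_⟩
  have key := pr_kill D (Lk Δ σ) (fun _ h => h) (fun G => D.cf G (ψ G)) z hz hz0
    (fun F => D.κ (c F) * D.cf ∅ p.1 + D.κ (c' F) * D.cf ∅ p.2) (by
      intro F hF
      rw [← cf_dy D F hF, ← hψ, Pi.add_apply, D.cf_add F hF, Pi.smul_apply, Pi.smul_apply, smul_eq_mul,
        smul_eq_mul, cf_phi D F hF, cf_phi D F hF])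
  rw [map_pr, map_pr]
  rw [← key]
  unfold pr
  rw [Finset.sum_mul, Finset.sum_mul, ← Finset.sum_add_distrib]
  refine Finset.sum_congr rfl fun S _ => ?_
  ring

lemma T2aux (c c' : Finset (Fin n) → k) (v v' : Fin n) (hv : v ≠ v') (p p' : A) (ψ : Finset (Fin n) → A)
    (hψ : p • Ev v (phi D c) + p' • Ev v' (phi D c') = dy D.y ψ) (z : Finset (Fin n) → k)
    (hz : On (fun S => Lk Δ σ S ∧ v ∉ S) z) (hz0 : Dy 1 z = 0) :
    D.κ (pr c z) * D.cf ∅ p = 0 := by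
  have key := pr_kill D _ (fun _ h => h.1) (fun G => D.cf G ((-Cv v ψ) G)) z hz hz0
    (fun F => D.κ (c F) * D.cf ∅ p) (by
      rintro F ⟨hF, hvF⟩
      have h1 := congrFun (congrArg (Cv v) hψ) F
      have h2 : Cv v (dy D.y ψ) = D.y v • ψ - dy D.y (Cv v ψ) := by
        rw [← dy_Cv D.y v ψ]; abel
      have h3 : Cv v (Ev v (phi D c)) F = phi D c F := by
        have := congrFun (Cv_Ev_self v (phi D c)) F
        rw [Pi.add_apply, Ev_apply, if_neg hvF, add_zero] at this
        exact this
      rw [map_add, map_smul, map_smul, Pi.add_apply, Pi.smul_apply, Pi.smul_apply, h3, Cv_Ev hv, h2] at h1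
      have h4 := congrArg (D.cf F) h1
      rw [D.cf_add F hF, smul_eq_mul, smul_eq_mul, cf_phi D F hF] at h4
      have h5 : D.cf F (p' * (-Ev v' (Cv v (phi D c'))) F) = 0 := by
        rw [Pi.neg_apply, Ev_apply]
        split_ifs with h
        · rw [Cv_apply, if_neg (by simp [hvF])]
          unfold phi
          rw [Finset.prod_insert (by simp [hvF])]
          rw [show p' * -(sg A F v' * (sg A (F.erase v') v * (D.ι (c' (insert v (F.erase v'))) * (D.y v * ∏ x ∈ F.erase v', D.y x)))) =
            D.y v * (p' * -(sg A F v' * (sg A (F.erase v') v * (D.ι (c' (insert v (F.erase v'))) * (∏ x ∈ F.erase v', D.y x))))) by ring]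
          rw [D.cf_y F hF, if_neg hvF]
        · simp [cf_zero D F hF]
      rw [h5, add_zero] at h4
      rw [h4, ← cf_dy D F hF, map_neg, sub_eq_add_neg, Pi.add_apply, D.cf_add F hF, Pi.smul_apply, smul_eq_mul, D.cf_y F hF,
        if_neg hvF, zero_add])
  rw [map_pr, ← key]
  unfold pr
  rw [Finset.sum_mul]
  refine Finset.sum_congr rfl fun S _ => ?_
  ring

lemma T2cyc (c : Finset (Fin n) → k) (v : Fin n) (h0 : ∀ F, Lk Δ σ F ∧ v ∉ F → dy 1 c F = 0) :
    dy D.y (Ev v (phi D c)) = 0 := by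
  rw [dy_Ev, phi_dy]
  funext S
  rw [Pi.neg_apply, Ev_apply]
  split_ifs with h
  · rw [phi_zero D _ _ (fun hL => h0 _ ⟨hL, by simp⟩)]; simp
  · simp

lemma T2 [IsNoetherianRing A] (e : ℕ) (hK : ∀ i < e, Subsingleton (XT A (A ⧸ IsLocalRing.maximalIdeal A) i))
    (s : Set (A × A)) (j : ℕ) (hj : j + 1 ≤ e) (hQ : QP s (XT A (A ⧸ IsLocalRing.maximalIdeal A) (j + 1)))
    (v v' : Fin n) (hv : v ≠ v')
    (c c' : Finset (Fin n) → k) (hc : Sup j c) (hc' : Sup j c')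
    (h0 : ∀ F, Lk Δ σ F ∧ v ∉ F → dy 1 c F = 0) (h0' : ∀ F, Lk Δ σ F ∧ v' ∉ F → dy 1 c' F = 0) :
    ∃ p ∈ s, (∀ z, On (fun S => Lk Δ σ S ∧ v ∉ S) z → Dy 1 z = 0 →
      D.κ (pr c z) * D.cf ∅ p.1 = 0) ∧
      (∀ z, On (fun S => Lk Δ σ S ∧ v' ∉ S) z → Dy 1 z = 0 →
      D.κ (pr c' z) * D.cf ∅ p.2 = 0) := by
  obtain ⟨p, hp, ψ, hψ⟩ := kos_main (IsLocalRing.maximalIdeal A) D.y D.hy e hK s j hj hQ (Ev v (phi D c)) (Ev v' (phi D c'))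
    (Sup.Ev (fun S hS => by simp [phi, hc S hS]) _) (Sup.Ev (fun S hS => by simp [phi, hc' S hS]) _)
    (T2cyc D c v h0) (T2cyc D c' v' h0')
  refine ⟨p, hp, fun z hz hz0 => T2aux D c c' v v' hv _ _ ψ hψ z hz hz0, fun z hz hz0 => ?_⟩
  rw [add_comm] at hψ
  exact T2aux D c' c v' v hv.symm _ _ ψ hψ z hz hz0

end AO

section Out
variable {k : Type} [Field k] {n : ℕ} {Δ : SC n} {σ : Finset (Fin n)}

lemma gorLR (hGP : GorensteinPunctured k (srIdeal k Δ)) (hσ : σ ∈ Δ.faces) (hne : σ.Nonempty) :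
    IsGorensteinLocalRing (LR k Δ hσ) :=
  hGP (Pf k Δ hσ) (Pf_homog k Δ hσ) (Pf_ne k Δ hσ hne)

theorem outA (hGP : GorensteinPunctured k (srIdeal k Δ)) (hσ : σ ∈ Δ.faces) (hne : σ.Nonempty)
    (F0 : Finset (Fin n)) (hF0 : Lk Δ σ F0) (j : ℕ) (hj : 1 ≤ j) (hj' : j < F0.card) (z : Finset (Fin n) → k)
    (hz : Sup j z) (hzo : On (Lk Δ σ) z) (hz0 : Dy 1 z = 0) :
    ∃ y, Sup (j + 1) y ∧ On (Lk Δ σ) y ∧ Dy 1 y = z := by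
  by_contra hcon
  have hG := gorLR hGP hσ hne
  have : IsNoetherianRing (LR k Δ hσ) := hG.1
  obtain ⟨hK, -⟩ := gor_out hG F0.card (LR_dim k Δ hσ F0 hF0)
  obtain ⟨c, hc, hc0, hcz⟩ := dual_ex (Lk Δ σ) j z hz hcon
  obtain ⟨i, rfl⟩ : ∃ i, j = i + 1 := ⟨j - 1, by omega⟩
  obtain ⟨p, hp, h⟩ := T1 (detLR k Δ hσ) F0.card hK {(1, 0)} i (by omega) ((QP_sub _).2 (hK _ hj')) c 0 hc
    (fun _ _ => rfl) hc0 (fun F _ => by simp)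
  rw [Set.mem_singleton_iff] at hp
  subst hp
  have h1 := h z hzo hz0
  have h2 := (detLR k Δ hσ).cf_unit 1 (by
    rw [IsLocalRing.mem_maximalIdeal]
    simp)
  have h3 : pr (0 : Finset (Fin n) → k) z = 0 := by simp [pr]
  rw [h3, map_zero, zero_mul, add_zero, mul_eq_zero] at h1
  rcases h1 with h1 | h1
  · rw [map_eq_zero] at h1
    exact hcz h1
  · exact h2 h1

lemma fun_pr (j : ℕ) (ℓ : (Finset (Fin n) → k) →ₗ[k] k) :
    ∃ c : Finset (Fin n) → k, Sup j c ∧ ∀ w, Sup j w → pr c w = ℓ w := by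
  classical
  let c : Finset (Fin n) → k := fun S => if S.card = j then ℓ (Pi.single S 1) else 0
  refine ⟨c, fun S hS => if_neg hS, ?_⟩
  intro w hw
  conv_rhs => rw [pi_eq_sum_univ' w, map_sum]
  unfold pr
  refine Finset.sum_congr rfl fun S _ => ?_
  rw [map_smul, smul_eq_mul, mul_comm]
  by_cases hS : S.card = j
  · simp only [c, if_pos hS]
  · rw [hw S hS]; simp

theorem outB0 (hGP : GorensteinPunctured k (srIdeal k Δ)) (hσ : σ ∈ Δ.faces) (hne : σ.Nonempty)
    (F0 : Finset (Fin n)) (hF0 : Lk Δ σ F0) (hpos : 1 ≤ F0.card) (hmax : ∀ F, Lk Δ σ F → F.card ≤ F0.card)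
    (z z' : Finset (Fin n) → k) (hz : Sup F0.card z) (hzo : On (Lk Δ σ) z) (hz0 : Dy 1 z = 0)
    (hz' : Sup F0.card z') (hzo' : On (Lk Δ σ) z') (hz0' : Dy 1 z' = 0) (hzne : z ≠ 0) :
    ∃ r : k, z' = r • z := by
  by_contra hcon
  have hG := gorLR hGP hσ hne
  have : IsNoetherianRing (LR k Δ hσ) := hG.1
  obtain ⟨hK, hQ⟩ := gor_out hG F0.card (LR_dim k Δ hσ F0 hF0)
  have hn1 : z' ∉ Submodule.span k {z} := by
    intro h
    rw [Submodule.mem_span_singleton] at h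
    obtain ⟨r, hr⟩ := h
    exact hcon ⟨r, hr.symm⟩
  have hn2 : z ∉ (⊥ : Submodule k (Finset (Fin n) → k)) := by simpa using hzne
  obtain ⟨ℓ', hℓ1, hℓ2⟩ := Submodule.exists_le_ker_of_notMem hn1
  obtain ⟨ℓ, hℓ, -⟩ := Submodule.exists_le_ker_of_notMem hn2
  have hℓ3 : ℓ' z = 0 := hℓ2 (Submodule.mem_span_singleton_self z)
  obtain ⟨c, hc, hcp⟩ := fun_pr F0.card ℓ
  obtain ⟨c', hc', hcp'⟩ := fun_pr F0.card ℓ'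
  obtain ⟨j, hj⟩ : ∃ j, F0.card = j + 1 := ⟨F0.card - 1, by omega⟩
  have hcoc : ∀ c : Finset (Fin n) → k, Sup F0.card c → ∀ F, Lk Δ σ F → dy 1 c F = 0 := by
    intro c hc F hF
    apply hc.dy 1 F
    have := hmax F hF
    omega
  obtain ⟨p, hp, h⟩ := T1 (detLR k Δ hσ) F0.card hK _ j (by omega) (hj ▸ hQ) c c' (hj ▸ hc) (hj ▸ hc')
    (hcoc c hc) (hcoc c' hc')
  have h1 := h z hzo hz0
  have h2 := h z' hzo' hz0'
  rw [hcp _ hz, hcp' _ hz, hℓ3, map_zero, zero_mul, add_zero, mul_eq_zero, map_eq_zero] at h1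
  have h3 := h1.resolve_left hℓ
  rw [h3, mul_zero, zero_add, hcp' _ hz', mul_eq_zero, map_eq_zero] at h2
  have h4 := h2.resolve_left hℓ1
  rcases hp with hp | hp
  · exact (detLR k Δ hσ).cf_unit _ hp h3
  · exact (detLR k Δ hσ).cf_unit _ hp h4

theorem outB1 (hGP : GorensteinPunctured k (srIdeal k Δ)) (hσ : σ ∈ Δ.faces) (hne : σ.Nonempty)
    (F0 : Finset (Fin n)) (hF0 : Lk Δ σ F0) (j : ℕ) (hj : F0.card = j + 1)
    (v v' : Fin n) (hv : v ≠ v')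
    (z z' : Finset (Fin n) → k)
    (hz : Sup j z) (hzo : On (fun S => Lk Δ σ S ∧ v ∉ S) z) (hz0 : Dy 1 z = 0)
    (hz' : Sup j z') (hzo' : On (fun S => Lk Δ σ S ∧ v' ∉ S) z') (hz0' : Dy 1 z' = 0)
    (hb : ¬ ∃ y, Sup (j + 1) y ∧ On (fun S => Lk Δ σ S ∧ v ∉ S) y ∧ Dy 1 y = z)
    (hb' : ¬ ∃ y, Sup (j + 1) y ∧ On (fun S => Lk Δ σ S ∧ v' ∉ S) y ∧ Dy 1 y = z') : False := by
  have hG := gorLR hGP hσ hne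
  have : IsNoetherianRing (LR k Δ hσ) := hG.1
  obtain ⟨hK, hQ⟩ := gor_out hG F0.card (LR_dim k Δ hσ F0 hF0)
  obtain ⟨c, hc, hc0, hcz⟩ := dual_ex _ j z hz hb
  obtain ⟨c', hc', hc0', hcz'⟩ := dual_ex _ j z' hz' hb'
  obtain ⟨p, hp, h, h'⟩ := T2 (detLR k Δ hσ) F0.card hK _ j (by omega) (hj ▸ hQ) v v' hv c c' hc hc' hc0 hc0'
  have h1 := h z hzo hz0
  have h2 := h' z' hzo' hz0'
  rw [mul_eq_zero, map_eq_zero] at h1 h2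
  rcases hp with hp | hp
  · exact (detLR k Δ hσ).cf_unit _ hp (h1.resolve_left hcz)
  · exact (detLR k Δ hσ).cf_unit _ hp (h2.resolve_left hcz')

end Out
end GP


namespace GP

section Comb
variable {k : Type} [Field k] {n : ℕ} {Δ : SC n}

lemma Lk_single {σ : Finset (Fin n)} {u} : Lk Δ σ {u} ↔ u ∉ σ ∧ insert u σ ∈ Δ.faces := by
  unfold Lk
  rw [Finset.disjoint_singleton_left, Finset.singleton_union]

lemma Lk_insert {σ F : Finset (Fin n)} {u} (hu : u ∉ σ) : Lk Δ (insert u σ) F ↔ u ∉ F ∧ Lk Δ σ (insert u F) := by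
  unfold Lk
  rw [Finset.disjoint_insert_right, Finset.disjoint_insert_left, Finset.insert_union, Finset.union_insert]
  tauto

lemma exists_facet {σ : Finset (Fin n)} (hσ : σ ∈ Δ.faces) : ∃ N, Δ.IsFacet N ∧ σ ⊆ N := by
  obtain ⟨N, h1, h2⟩ := Δ.faces.exists_le_maximal hσ
  exact ⟨N, ⟨h2.1, fun τ hτ h => le_antisymm h (h2.2 hτ h)⟩, h1⟩

/-- path connectivity of a link -/
def Cnn (Δ : SC n) (σ : Finset (Fin n)) : Prop := ∀ p q, Lk Δ σ {p} → Lk Δ σ {q} →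
  Relation.ReflTransGen (fun a b => Lk Δ σ {a, b}) p q

lemma dy_congr {R : Type} [CommRing R] (y : Fin n → R) (f g : Finset (Fin n) → R) (S)
    (h : ∀ i ∈ S, f (S.erase i) = g (S.erase i)) : dy y f S = dy y g S := by
  rw [dy_apply, dy_apply]
  refine Finset.sum_congr rfl fun i _ => ?_
  rw [Ev_apply, Ev_apply]
  split_ifs with hi
  · rw [h i hi]
  · rfl

lemma dy_single_empty {R : Type} [CommRing R] (v : Fin n) :
    dy (1 : Fin n → R) (Pi.single ∅ 1) {v} = 1 := by
  rw [dy_apply, Finset.sum_eq_single v]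
  · rw [Ev_apply, if_pos (Finset.mem_singleton_self v)]
    simp [sg, Finset.filter_singleton]
  · intro b _ hb
    rw [Ev_apply, if_neg (by simpa using hb)]; simp
  · simp

lemma Dy_single {R : Type} [CommRing R] (v : Fin n) :
    Dy (1 : Fin n → R) (Pi.single {v} 1) = Pi.single ∅ 1 := by
  funext S
  rw [← pr_single (Dy 1 (Pi.single {v} 1)) S]
  have : pr (Dy 1 (Pi.single {v} 1)) (Pi.single S 1) = pr (Pi.single S 1) (Dy (1 : Fin n → R) (Pi.single {v} 1)) := by
    simp [pr, mul_comm]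
  rw [this, pr_Dy, pr_single]
  by_cases hS : S = ∅
  · subst hS; rw [dy_single_empty]; simp
  · rw [Pi.single_eq_of_ne hS, dy_apply]
    refine Finset.sum_eq_zero fun i _ => ?_
    rw [Ev_apply]
    split_ifs with h
    · rw [Finset.mem_singleton] at h
      subst h
      rw [Finset.erase_singleton, Pi.single_eq_of_ne (Ne.symm hS)]; simp
    · simp

lemma Sup_single {R : Type} [CommRing R] (S : Finset (Fin n)) : Sup S.card (Pi.single S (1 : R)) := by
  intro T hT
  rw [Pi.single_eq_of_ne]
  rintro rfl; exact hT rfl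

lemma Sup_single1 {R : Type} [CommRing R] (v : Fin n) : Sup 1 (Pi.single {v} (1 : R)) := Sup_single {v}

lemma On_single {R : Type} [CommRing R] (P : Finset (Fin n) → Prop) (S : Finset (Fin n)) (h : P S) :
    On P (Pi.single S (1 : R)) := by
  intro T hT
  rw [Pi.single_eq_of_ne]
  rintro rfl; exact hT h

lemma Sup.sub {R : Type} [CommRing R] {q : ℕ} {f g : Finset (Fin n) → R} (hf : Sup q f) (hg : Sup q g) :
    Sup q (f - g) := fun S hS => by rw [Pi.sub_apply, hf S hS, hg S hS, sub_zero]

lemma On.sub {R : Type} [CommRing R] {P : Finset (Fin n) → Prop} {f g : Finset (Fin n) → R} (hf : On P f) (hg : On P g) :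
    On P (f - g) := fun S hS => by rw [Pi.sub_apply, hf S hS, hg S hS, sub_zero]

theorem cnn_lk (hGP : GorensteinPunctured k (srIdeal k Δ)) {σ : Finset (Fin n)} (hσ : σ ∈ Δ.faces) (hne : σ.Nonempty)
    (F0 : Finset (Fin n)) (hF0 : Lk Δ σ F0) (h2 : 2 ≤ F0.card) : Cnn Δ σ := by
  classical
  intro p q hp hq
  obtain ⟨y, hy, hyo, hyz⟩ := outA hGP hσ hne F0 hF0 1 le_rfl (by omega)
    (Pi.single {p} 1 - Pi.single {q} 1) ((Sup_single1 p).sub (Sup_single1 q))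
    ((On_single _ _ hp).sub (On_single _ _ hq)) (by rw [map_sub, Dy_single, Dy_single, sub_self])
  let h : Finset (Fin n) → k := fun S => if ∃ v, S = {v} ∧ Relation.ReflTransGen (fun a b => Lk Δ σ {a, b}) p v then 1 else 0
  have h1 : pr h (Dy 1 y) = 0 := by
    rw [pr_Dy]
    unfold pr
    refine Finset.sum_eq_zero fun S _ => ?_
    by_cases hS : S.card = 2 ∧ Lk Δ σ S
    · suffices hd : dy 1 h S = 0 by rw [hd, zero_mul]
      obtain ⟨a, b, hab, rfl⟩ := Finset.card_eq_two.1 hS.1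
      have ea : ({a, b} : Finset (Fin n)).erase a = {b} :=
        Finset.erase_insert (by simpa using hab)
      have eb : ({a, b} : Finset (Fin n)).erase b = {a} := by
        ext x; simp; constructor
        · rintro ⟨h1, h2⟩; exact h2.resolve_right h1
        · rintro rfl; exact ⟨hab, Or.inl rfl⟩
      have hba : Lk Δ σ {b, a} := by rw [Finset.pair_comm]; exact hS.2
      have hv : ∀ v, h {v} = if Relation.ReflTransGen (fun a b => Lk Δ σ {a, b}) p v then 1 else 0 := by
        intro v
        simp only [h]
        congr 1
        simp
      by_cases hr : Relation.ReflTransGen (fun a b => Lk Δ σ {a, b}) p a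
      · have hr' := hr.tail hS.2
        have := congrFun (dy_dy (1 : Fin n → k) (Pi.single ∅ 1)) {a, b}
        rw [dy_congr 1 h (dy 1 (Pi.single ∅ 1)) {a, b}, this]; rfl
        intro i hi
        simp only [Finset.mem_insert, Finset.mem_singleton] at hi
        rcases hi with rfl | rfl
        · rw [ea, dy_single_empty, hv, if_pos hr']
        · rw [eb, dy_single_empty, hv, if_pos hr]
      · have hr' : ¬ Relation.ReflTransGen (fun a b => Lk Δ σ {a, b}) p b := fun h => hr (h.tail hba)
        rw [dy_congr 1 h 0 {a, b}, map_zero]; rfl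
        intro i hi
        simp only [Finset.mem_insert, Finset.mem_singleton] at hi
        rcases hi with rfl | rfl
        · rw [ea, hv, if_neg hr']; rfl
        · rw [eb, hv, if_neg hr]; rfl
    · have : y S = 0 := by
        by_cases hc : S.card = 2
        · exact hyo S (fun h => hS ⟨hc, h⟩)
        · exact hy S hc
      rw [this, mul_zero]
  rw [hyz] at h1
  have h3 : pr h (Pi.single {p} 1 - Pi.single {q} 1) = h {p} - h {q} := by
    rw [← pr_single h {p}, ← pr_single h {q}]
    unfold pr
    rw [← Finset.sum_sub_distrib]
    refine Finset.sum_congr rfl fun S _ => ?_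
    rw [Pi.sub_apply, mul_sub]
  rw [h3] at h1
  by_contra hc
  have e1 : h {p} = 1 := if_pos ⟨p, rfl, Relation.ReflTransGen.refl⟩
  have e2 : h {q} = 0 := if_neg (by
    rintro ⟨v, hv, h⟩
    rw [Finset.singleton_inj] at hv
    subst hv
    exact hc h)
  rw [e1, e2] at h1
  simp at h1

lemma pure_step {σ : Finset (Fin n)} (hC : Cnn Δ σ)
    (ih : ∀ u, u ∉ σ → ∀ N N', Δ.IsFacet N → Δ.IsFacet N' → insert u σ ⊆ N → insert u σ ⊆ N' → N.card = N'.card)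
    (N N' : Finset (Fin n)) (hN : Δ.IsFacet N) (hN' : Δ.IsFacet N') (hs : σ ⊆ N) (hs' : σ ⊆ N') : N.card = N'.card := by
  by_cases h1 : N ⊆ σ
  · have : N = σ := le_antisymm h1 hs
    subst this
    rw [hN.2 N' hN'.1 hs']
  by_cases h2 : N' ⊆ σ
  · have : N' = σ := le_antisymm h2 hs'
    subst this
    rw [hN'.2 N hN.1 hs]
  rw [Finset.not_subset] at h1 h2
  obtain ⟨p, hp, hp'⟩ := h1
  obtain ⟨q, hq, hq'⟩ := h2
  have hpN : insert p σ ⊆ N := Finset.insert_subset hp hs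
  have hqN : insert q σ ⊆ N' := Finset.insert_subset hq hs'
  have path := hC p q (Lk_single.2 ⟨hp', Δ.down_closed hN.1 hpN⟩) (Lk_single.2 ⟨hq', Δ.down_closed hN'.1 hqN⟩)
  have key : q ∉ σ ∧ ∀ M, Δ.IsFacet M → insert q σ ⊆ M → N.card = M.card := by
    clear hqN hq hq'
    induction path with
    | refl => exact ⟨hp', fun M hM h => ih p hp' N M hN hM hpN h⟩
    | @tail b c _ hbc ihp =>
      have hcσ : c ∉ σ := fun h => Finset.disjoint_left.1 hbc.1 (by simp) h
      refine ⟨hcσ, fun M hM h => ?_⟩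
      obtain ⟨M', hM', hs⟩ := exists_facet hbc.2
      rw [ihp.2 M' hM' (fun x hx => hs (by simp at hx ⊢; tauto))]
      exact ih c hcσ M' M hM' hM (fun x hx => hs (by simp at hx ⊢; tauto)) h
  exact key.2 N' hN' hqN

theorem pure_ne (hGP : GorensteinPunctured k (srIdeal k Δ)) : ∀ (c : ℕ) (σ : Finset (Fin n)), c + σ.card = n → σ.Nonempty →
    ∀ N N', Δ.IsFacet N → Δ.IsFacet N' → σ ⊆ N → σ ⊆ N' → N.card = N'.card := by
  intro c
  induction c with
  | zero =>
    intro σ hc hne N N' hN hN' hs hs'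
    have hle : N.card ≤ n := by simpa using Finset.card_le_univ N
    have hle' : N'.card ≤ n := by simpa using Finset.card_le_univ N'
    have := Finset.card_le_card hs
    have := Finset.card_le_card hs'
    omega
  | succ c ih =>
    intro σ hc hne N N' hN hN' hs hs'
    have ih' : ∀ u, u ∉ σ → ∀ N N', Δ.IsFacet N → Δ.IsFacet N' → insert u σ ⊆ N → insert u σ ⊆ N' → N.card = N'.card := by
      intro u hu
      exact ih (insert u σ) (by rw [Finset.card_insert_of_notMem hu]; omega) (Finset.insert_nonempty _ _)
    have hσ := Δ.down_closed hN.1 hs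
    have hL : ∀ M, Δ.IsFacet M → σ ⊆ M → Lk Δ σ (M \ σ) := fun M hM h =>
      ⟨Finset.sdiff_disjoint, by rw [Finset.sdiff_union_of_subset h]; exact hM.1⟩
    by_cases h2 : 2 ≤ (N \ σ).card
    · exact pure_step (cnn_lk hGP hσ hne _ (hL N hN hs) h2) ih' N N' hN hN' hs hs'
    by_cases h2' : 2 ≤ (N' \ σ).card
    · exact pure_step (cnn_lk hGP hσ hne _ (hL N' hN' hs') h2') ih' N N' hN hN' hs hs'
    have e1 := Finset.card_sdiff_add_card_eq_card hs
    have e2 := Finset.card_sdiff_add_card_eq_card hs'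
    have e3 : (N \ σ).card = 0 → N' = σ := by
      intro h
      have : N = σ := Finset.Subset.antisymm (by rwa [Finset.card_eq_zero, Finset.sdiff_eq_empty_iff_subset] at h) hs
      subst this
      exact (hN.2 N' hN'.1 hs').symm
    have e4 : (N' \ σ).card = 0 → N = σ := by
      intro h
      have : N' = σ := Finset.Subset.antisymm (by rwa [Finset.card_eq_zero, Finset.sdiff_eq_empty_iff_subset] at h) hs'
      subst this
      exact (hN'.2 N hN.1 hs).symm
    by_cases h0 : (N \ σ).card = 0
    · have := e3 h0; subst this
      simp at e2; omega
    by_cases h0' : (N' \ σ).card = 0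
    · have := e4 h0'; subst this
      simp at e1; omega
    omega

theorem pure_all (hGP : GorensteinPunctured k (srIdeal k Δ)) (hC : Cnn Δ ∅) 
    (N N' : Finset (Fin n)) (hN : Δ.IsFacet N) (hN' : Δ.IsFacet N') : N.card = N'.card := by
  refine pure_step hC ?_ N N' hN hN' (Finset.empty_subset _) (Finset.empty_subset _)
  intro u hu
  refine pure_ne hGP (n - 1) (insert u ∅) ?_ (Finset.insert_nonempty _ _)
  simp
  have := u.2
  omega

end Comb
end GP


namespace GP

section Inter
variable {k : Type} [Field k] {n : ℕ} {Δ : SC n}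

/-- cycles of a given degree on the link -/
def TopC (Δ : SC n) (σ : Finset (Fin n)) (m : ℕ) (z : Finset (Fin n) → k) : Prop :=
  Sup m z ∧ On (Lk Δ σ) z ∧ Dy 1 z = 0

/-- interior faces -/
def Inr (k : Type) [Field k] (Δ : SC n) (D : ℕ) (σ : Finset (Fin n)) : Prop :=
  ∃ (m : ℕ) (z : Finset (Fin n) → k), σ.card + m = D ∧ TopC Δ σ m z ∧ z ≠ 0

/-- cone points over `σ` -/
def Cn (Δ : SC n) (σ : Finset (Fin n)) (w : Fin n) : Prop := w ∉ σ ∧ ∀ N, Δ.IsFacet N → σ ⊆ N → w ∈ N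

lemma TopC.Cv {σ : Finset (Fin n)} {m : ℕ} {z : Finset (Fin n) → k} (h : TopC Δ σ (m + 1) z) {u : Fin n} (hu : u ∉ σ) :
    TopC Δ (insert u σ) m (Cv u z) := by
  refine ⟨?_, ?_, ?_⟩
  · intro S hS
    rw [Cv_apply]
    split_ifs with h'
    · rfl
    · rw [h.1, mul_zero]
      rw [Finset.card_insert_of_notMem h']; omega
  · intro S hS
    rw [Cv_apply]
    split_ifs with h'
    · rfl
    · rw [h.2.1, mul_zero]
      intro hL
      exact hS ((Lk_insert hu).2 ⟨h', hL⟩)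
  · rw [Dy_Cv, h.2.2]; simp

lemma sg_ne (S : Finset (Fin n)) (v) : sg k S v ≠ 0 := by
  intro h
  have := sg_mul_self (R := k) S v
  rw [h] at this; simp at this

lemma Cv_ne (u : Fin n) (z : Finset (Fin n) → k) (S) (hu : u ∈ S) : Cv u z (S.erase u) ≠ 0 ↔ z S ≠ 0 := by
  rw [Cv_apply, if_neg (by simp), Finset.insert_erase hu]
  simp [sg_ne]

variable {D : ℕ} (hpure : ∀ N, Δ.IsFacet N → N.card = D)

include hpure in
lemma facet_of_card {S : Finset (Fin n)} (hS : S ∈ Δ.faces) (h : D ≤ S.card) : Δ.IsFacet S := by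
  obtain ⟨N, hN, hs⟩ := exists_facet hS
  have := Finset.eq_of_subset_of_card_le hs (by rw [hpure N hN]; exact h)
  rwa [this]

include hpure in
lemma face_card_le {S : Finset (Fin n)} (hS : S ∈ Δ.faces) : S.card ≤ D := by
  obtain ⟨N, hN, hs⟩ := exists_facet hS
  rw [← hpure N hN]; exact Finset.card_le_card hs

include hpure in
lemma Lk_facet {σ N : Finset (Fin n)} (hN : Δ.IsFacet N) (hs : σ ⊆ N) {m : ℕ} (hm : σ.card + m = D) :
    Lk Δ σ (N \ σ) ∧ (N \ σ).card = m := by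
  refine ⟨⟨Finset.sdiff_disjoint, by rw [Finset.sdiff_union_of_subset hs]; exact hN.1⟩, ?_⟩
  have := Finset.card_sdiff_add_card_eq_card hs
  rw [hpure N hN] at this
  omega

include hpure in
lemma exists_top {σ : Finset (Fin n)} (hσ : σ ∈ Δ.faces) {m : ℕ} (hm : σ.card + m = D) :
    ∃ F, Lk Δ σ F ∧ F.card = m := by
  obtain ⟨N, hN, hs⟩ := exists_facet hσ
  exact ⟨_, Lk_facet hpure hN hs hm⟩

include hpure in
lemma Lk_card_le {σ F : Finset (Fin n)} (hF : Lk Δ σ F) {m : ℕ} (hm : σ.card + m = D) : F.card ≤ m := by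
  have := face_card_le hpure hF.2
  rw [Finset.card_union_of_disjoint hF.1] at this
  omega

include hpure in
lemma cnn_pure (hGP : GorensteinPunctured k (srIdeal k Δ)) {σ : Finset (Fin n)} (hσ : σ ∈ Δ.faces) (hne : σ.Nonempty)
    {m : ℕ} (hm : σ.card + m = D) (h2 : 2 ≤ m) : Cnn Δ σ := by
  obtain ⟨F, hF, hc⟩ := exists_top hpure hσ hm
  exact cnn_lk hGP hσ hne F hF (by omega)

lemma two_pts {σ : Finset (Fin n)} {p r : Fin n} (hp : Lk Δ σ {p}) (hr : Lk Δ σ {r}) :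
    TopC Δ σ 1 (Pi.single {p} (1 : k) - Pi.single {r} 1 : Finset (Fin n) → k) :=
  ⟨(Sup_single1 p).sub (Sup_single1 r), (On_single _ _ hp).sub (On_single _ _ hr), by rw [map_sub, Dy_single, Dy_single, sub_self]⟩

lemma two_pts_l {p r : Fin n} (h : p ≠ r) : (Pi.single {p} (1 : k) - Pi.single {r} 1 : Finset (Fin n) → k) {p} = 1 := by
  rw [Pi.sub_apply, Pi.single_eq_same, Pi.single_eq_of_ne, sub_zero]
  simpa using h

include hpure in
theorem FS (hGP : GorensteinPunctured k (srIdeal k Δ)) : ∀ (m : ℕ) (σ : Finset (Fin n)), σ ∈ Δ.faces → σ.Nonempty →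
    σ.card + m = D → ∀ z : Finset (Fin n) → k, TopC Δ σ m z → z ≠ 0 → ∀ N, Δ.IsFacet N → σ ⊆ N → z (N \ σ) ≠ 0 := by
  intro m
  induction m with
  | zero =>
    intro σ hσ hne hm z hz hz0 N hN hs
    have h1 := (Lk_facet hpure hN hs hm).2
    rw [Finset.card_eq_zero] at h1
    rw [h1]
    intro h
    apply hz0
    funext S
    by_cases hS : S = ∅
    · subst hS; exact h
    · exact hz.1 S (by rwa [Ne, Finset.card_eq_zero])
  | succ m ih =>
    intro σ hσ hne hm z hz hz0 N hN hs
    obtain ⟨G, hG⟩ := Function.ne_iff.1 hz0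
    have hGc : G.card = m + 1 := by by_contra h; exact hG (hz.1 G h)
    have hGL : Lk Δ σ G := by by_contra h; exact hG (hz.2.1 G h)
    obtain ⟨hNL, hNc⟩ := Lk_facet hpure hN hs hm
    by_cases hm0 : m = 0
    · subst hm0
      obtain ⟨p, rfl⟩ := Finset.card_eq_one.1 hGc
      obtain ⟨r, hr⟩ := Finset.card_eq_one.1 hNc
      rw [hr] at hNL ⊢
      by_cases hpr : p = r
      · subst hpr; exact hG
      have ht := two_pts (k := k) hNL hGL
      obtain ⟨c, hc⟩ := outB0 hGP hσ hne {p} hGL (by simp) (fun F hF => by simpa using Lk_card_le hpure hF hm)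
        z _ hz.1 hz.2.1 hz.2.2 ht.1 ht.2.1 ht.2.2 hz0
      intro h
      have h1 := congrFun hc {r}
      rw [two_pts_l (Ne.symm hpr), Pi.smul_apply, h] at h1
      simp at h1
    · have hC := cnn_pure hpure hGP hσ hne hm (by omega)
      have step : ∀ u, u ∉ σ → Cv u z ≠ 0 → ∀ M, Δ.IsFacet M → insert u σ ⊆ M → z (M \ σ) ≠ 0 := by
        intro u hu h0 M hM hMs
        have := ih (insert u σ) (Δ.down_closed hM.1 hMs) (Finset.insert_nonempty _ _)
          (by rw [Finset.card_insert_of_notMem hu]; omega) _ (hz.Cv hu) h0 M hM hMs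
        rw [Finset.sdiff_insert, Cv_ne] at this
        · exact this
        · exact Finset.mem_sdiff.2 ⟨hMs (Finset.mem_insert_self _ _), hu⟩
      obtain ⟨p, hp⟩ : G.Nonempty := by rw [← Finset.card_pos]; omega
      obtain ⟨q, hq⟩ : (N \ σ).Nonempty := by rw [← Finset.card_pos]; omega
      have path := hC p q (hGL.mono (by simpa using hp)) (hNL.mono (by simpa using hq))
      rw [Finset.mem_sdiff] at hq
      have hpσ : p ∉ σ := Finset.disjoint_left.1 hGL.1 hp
      have key : q ∉ σ ∧ Cv q z ≠ 0 := by
        clear hq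
        induction path with
        | refl =>
          refine ⟨hpσ, fun h => ?_⟩
          exact (Cv_ne p z G hp).2 hG (congrFun h _)
        | @tail b c _ hbc ihp =>
          have hcσ : c ∉ σ := fun h => Finset.disjoint_left.1 hbc.1 (by simp) h
          refine ⟨hcσ, fun h => ?_⟩
          obtain ⟨M, hM, hMs⟩ := exists_facet hbc.2
          have h1 := step b ihp.1 ihp.2 M hM (fun x hx => hMs (by simp at hx ⊢; tauto))
          refine (Cv_ne c z (M \ σ) ?_).2 h1 (congrFun h _)
          exact Finset.mem_sdiff.2 ⟨hMs (by simp), hcσ⟩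
      exact step q key.1 key.2 N hN (Finset.insert_subset hq.1 hs)

include hpure in
theorem Inr_insert (hGP : GorensteinPunctured k (srIdeal k Δ)) {σ : Finset (Fin n)} {u : Fin n} (hne : σ.Nonempty)
    (hu : u ∉ σ) (hf : insert u σ ∈ Δ.faces) (h : Inr k Δ D σ) : Inr k Δ D (insert u σ) := by
  obtain ⟨m, z, hm, hz, hz0⟩ := h
  have hle := face_card_le hpure hf
  rw [Finset.card_insert_of_notMem hu] at hle
  obtain ⟨j, rfl⟩ : ∃ j, m = j + 1 := ⟨m - 1, by omega⟩
  refine ⟨j, Cv u z, by rw [Finset.card_insert_of_notMem hu]; omega, hz.Cv hu, fun h => ?_⟩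
  obtain ⟨N, hN, hs⟩ := exists_facet hf
  have h1 := FS hpure hGP _ σ (Δ.down_closed hf (Finset.subset_insert _ _)) hne hm z hz hz0 N hN
    ((Finset.subset_insert _ _).trans hs)
  refine (Cv_ne u z (N \ σ) ?_).2 h1 (congrFun h _)
  exact Finset.mem_sdiff.2 ⟨hs (Finset.mem_insert_self _ _), hu⟩

include hpure in
theorem Inr_up (hGP : GorensteinPunctured k (srIdeal k Δ)) : ∀ (c : ℕ) {σ τ : Finset (Fin n)}, (τ \ σ).card = c → σ.Nonempty →
    σ ⊆ τ → τ ∈ Δ.faces → Inr k Δ D σ → Inr k Δ D τ := by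
  intro c
  induction c with
  | zero =>
    intro σ τ hc hne hs hτ h
    rw [Finset.card_eq_zero, Finset.sdiff_eq_empty_iff_subset] at hc
    rwa [← Finset.Subset.antisymm hs hc]
  | succ c ih =>
    intro σ τ hc hne hs hτ h
    obtain ⟨u, hu⟩ : (τ \ σ).Nonempty := by rw [← Finset.card_pos]; omega
    have hu' := Finset.mem_sdiff.1 hu
    have hs' : insert u σ ⊆ τ := Finset.insert_subset hu'.1 hs
    refine ih ?_ (Finset.insert_nonempty _ _) hs' hτ (Inr_insert hpure hGP hne hu'.2 (Δ.down_closed hτ hs') h)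
    rw [Finset.sdiff_insert, Finset.card_erase_of_mem hu]; omega

include hpure in
theorem cone_not {σ : Finset (Fin n)} {w : Fin n} (h : Cn Δ σ w) : ¬ Inr k Δ D σ := by
  rintro ⟨m, z, hm, hz, hz0⟩
  have hw : ∀ G, z G ≠ 0 → w ∈ G := by
    intro G hG
    have hGc : G.card = m := by by_contra h; exact hG (hz.1 G h)
    have hGL : Lk Δ σ G := by by_contra h; exact hG (hz.2.1 G h)
    have hf := facet_of_card hpure hGL.2 (by rw [Finset.card_union_of_disjoint hGL.1]; omega)
    have := h.2 _ hf Finset.subset_union_right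
    rw [Finset.mem_union] at this
    exact this.resolve_right h.1
  obtain ⟨G, hG⟩ := Function.ne_iff.1 hz0
  have hwG := hw G hG
  have h1 := congrFun hz.2.2 (G.erase w)
  rw [Dy_apply, Finset.sum_eq_single w] at h1
  · rw [Pi.one_apply, one_mul] at h1
    exact (Cv_ne w z G hwG).2 hG h1
  · intro i _ hi
    rw [Cv_apply]
    split_ifs
    · simp
    · rw [show z (insert i (G.erase w)) = 0 by
        by_contra hc
        have := hw _ hc
        simp [hi.symm] at this]
      simp
  · simp

lemma nonbd {σ : Finset (Fin n)} {v : Fin n} (hv : v ∉ σ) {j : ℕ} {z : Finset (Fin n) → k} (hm : σ.card + (j + 1) = D)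
    (hz : TopC Δ (insert v σ) j z) (hz0 : z ≠ 0) (hn : ¬ Inr k Δ D σ) :
    On (fun S => Lk Δ σ S ∧ v ∉ S) z ∧ ¬ ∃ y, Sup (j + 1) y ∧ On (fun S => Lk Δ σ S ∧ v ∉ S) y ∧ Dy 1 y = z := by
  constructor
  · intro S hS
    apply hz.2.1
    intro h
    rw [Lk_insert hv] at h
    exact hS ⟨h.2.mono (Finset.subset_insert _ _), h.1⟩
  rintro ⟨y, hy, hyo, hyz⟩
  apply hn
  refine ⟨j + 1, Ev v z - y, hm, ⟨(hz.1.Ev v).sub hy, ?_, ?_⟩, ?_⟩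
  · apply On.sub
    · intro S hS
      rw [Ev_apply]
      split_ifs with h
      · rw [hz.2.1, mul_zero]
        rw [Lk_insert hv, Finset.insert_erase h]
        exact fun h => hS h.2
      · rfl
    · intro S hS
      exact hyo S (fun h => hS h.1)
  · have := Dy_Ev 1 v z
    rw [hz.2.2, map_zero, add_zero] at this
    rw [map_sub, this, hyz]; simp
  · intro h
    obtain ⟨S, hS⟩ := Function.ne_iff.1 hz0
    have hvS : v ∉ S := by
      intro hv'
      apply hS
      apply hz.2.1
      rw [Lk_insert hv]
      exact fun h => h.1 hv'
    have := congrFun h (insert v S)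
    rw [Pi.sub_apply, hyo (insert v S) (fun h => h.2 (Finset.mem_insert_self _ _)), sub_zero, Ev_apply,
      if_pos (Finset.mem_insert_self _ _), Finset.erase_insert hvS] at this
    exact mul_ne_zero (sg_ne _ _) hS this

include hpure in
theorem two_int (hGP : GorensteinPunctured k (srIdeal k Δ)) {σ : Finset (Fin n)} {v v' : Fin n} (hne : σ.Nonempty)
    (hv : v ∉ σ) (hv' : v' ∉ σ) (hf : insert v σ ∈ Δ.faces) (hvv : v ≠ v')
    (hn : ¬ Inr k Δ D σ) (h : Inr k Δ D (insert v σ)) (h' : Inr k Δ D (insert v' σ)) : False := by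
  obtain ⟨m, z, hm, hz, hz0⟩ := h
  obtain ⟨m', z', hm', hz', hz0'⟩ := h'
  rw [Finset.card_insert_of_notMem hv] at hm
  rw [Finset.card_insert_of_notMem hv'] at hm'
  obtain rfl : m = m' := by omega
  have hσ := Δ.down_closed hf (Finset.subset_insert _ _)
  obtain ⟨F, hF, hFc⟩ := exists_top hpure hσ (m := m + 1) (by omega)
  obtain ⟨a1, a2⟩ := nonbd hv (by omega) hz hz0 hn
  obtain ⟨b1, b2⟩ := nonbd hv' (by omega) hz' hz0' hn
  exact outB1 hGP hσ hne F hF m hFc v v' hvv z z' hz.1 a1 hz.2.2 hz'.1 b1 hz'.2.2 a2 b2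

end Inter
end GP


namespace GP

section Cone
variable {k : Type} [Field k] {n : ℕ} {Δ : SC n}
variable {D : ℕ} (hpure : ∀ N, Δ.IsFacet N → N.card = D) (hGP : GorensteinPunctured k (srIdeal k Δ))

/-- `w` is in all facets containing `σ` and `u` -/
def Qc (Δ : SC n) (σ : Finset (Fin n)) (w u : Fin n) : Prop := ∀ N, Δ.IsFacet N → insert u σ ⊆ N → w ∈ N

/-- induction hypothesis -/
def H1 (k : Type) [Field k] (Δ : SC n) (D : ℕ) (σ : Finset (Fin n)) : Prop :=
  ∀ τ ∈ Δ.faces, σ ⊂ τ → ¬ Inr k Δ D τ → ∃ w, Cn Δ τ w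

include hpure hGP in
theorem adj {σ : Finset (Fin n)} (h1 : H1 k Δ D σ) {w u u' : Fin n} (hw : w ∉ σ) (hwu : w ≠ u)
    (hQ : Qc Δ σ w u) (hu' : u' ∉ σ) (hf : Lk Δ σ {u, u'}) : Qc Δ σ w u' := by
  classical
  let M : Finset (Fin n) := Finset.univ.filter fun x => ∀ N, Δ.IsFacet N → insert u' σ ⊆ N → x ∈ N
  have hM : ∀ x, x ∈ M ↔ ∀ N, Δ.IsFacet N → insert u' σ ⊆ N → x ∈ N := by intro x; simp [M]
  by_contra hc
  have hwM : w ∉ M := fun h => hc ((hM w).1 h)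
  have hsM : insert u' σ ⊆ M := fun x hx => (hM x).2 fun N _ h => h hx
  obtain ⟨N, hN, hs⟩ := exists_facet hf.2
  have hsN : insert u' σ ⊆ N := fun x hx => hs (by simp at hx ⊢; tauto)
  have hMN : ∀ N, Δ.IsFacet N → insert u' σ ⊆ N → M ⊆ N := fun N hN h x hx => (hM x).1 hx N hN h
  have hMf : M ∈ Δ.faces := Δ.down_closed hN.1 (hMN N hN hsN)
  have hss : σ ⊂ M := by
    refine Finset.ssubset_iff_subset_ne.2 ⟨(Finset.subset_insert _ _).trans hsM, ?_⟩
    rintro h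
    apply hu'
    rw [h]; exact hsM (Finset.mem_insert_self _ _)
  have hMint : Inr k Δ D M := by
    by_contra hn
    obtain ⟨x, hx, hx'⟩ := h1 M hMf hss hn
    exact hx ((hM x).2 fun N hN h => hx' N hN (hMN N hN h))
  have huN : u ∈ N := hs (by simp)
  have hins : insert u M ⊆ N := Finset.insert_subset huN (hMN N hN hsN)
  have hint := Inr_up hpure hGP _ (τ := insert u M) rfl ⟨u', hsM (Finset.mem_insert_self _ _)⟩ (Finset.subset_insert _ _)
    (Δ.down_closed hN.1 hins) hMint
  refine cone_not hpure (w := w) ⟨?_, ?_⟩ hint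
  · rw [Finset.mem_insert]; rintro (h | h)
    · exact hwu h
    · exact hwM h
  · intro N' hN' hs'
    exact hQ N' hN' ((Finset.insert_subset_insert _ ((Finset.subset_insert _ _).trans hsM)).trans hs')

lemma Lk_pair {σ : Finset (Fin n)} {a b : Fin n} (h : Lk Δ σ {a, b}) : a ∉ σ ∧ b ∉ σ ∧ Lk Δ σ {a} ∧ Lk Δ σ {b} :=
  ⟨fun h' => Finset.disjoint_left.1 h.1 (by simp) h', fun h' => Finset.disjoint_left.1 h.1 (by simp) h',
    h.mono (by simp), h.mono (by simp)⟩

include hpure hGP in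
theorem h4 {σ : Finset (Fin n)} (h1 : H1 k Δ D σ) {m : ℕ} (hm : σ.card + m = D)
    (hcase : 3 ≤ m ∨ (m = 2 ∧ σ.Nonempty ∧ ¬ Inr k Δ D σ)) {w u u' : Fin n} (hwu : w ≠ u) (hwu' : w ≠ u')
    (hf : Lk Δ σ {w, u}) (hf' : Lk Δ σ {w, u'}) (hQ : Qc Δ σ w u) : Qc Δ σ w u' := by
  obtain ⟨hw, hu, hLw, -⟩ := Lk_pair hf
  obtain ⟨-, hu', -, -⟩ := Lk_pair hf'
  have hwf := (Lk_single.1 hLw).2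
  have hL : Lk Δ (insert w σ) {u} := (Lk_insert hw).2 ⟨by simpa using hwu, hf⟩
  have hL' : Lk Δ (insert w σ) {u'} := (Lk_insert hw).2 ⟨by simpa using hwu', hf'⟩
  rcases hcase with h3 | ⟨h2, hne, hn⟩
  · have hC := cnn_pure hpure hGP hwf (Finset.insert_nonempty _ _) (m := m - 1)
      (by rw [Finset.card_insert_of_notMem hw]; omega) (by omega)
    have path := hC u u' hL hL'
    have key : w ≠ u' ∧ Qc Δ σ w u' := by
      clear hf' hu' hwu' hL'
      induction path with
      | refl => exact ⟨hwu, hQ⟩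
      | @tail b c _ hbc ih =>
        obtain ⟨h5, h6⟩ := (Lk_insert hw).1 hbc
        obtain ⟨-, h7, -, -⟩ := Lk_pair hbc
        rw [Finset.mem_insert, not_or] at h7
        exact ⟨fun h => h7.1 h.symm, adj hpure hGP h1 hw ih.1 ih.2 h7.2 (h6.mono (Finset.subset_insert _ _))⟩
    exact key.2
  · subst h2
    by_cases huu : u = u'
    · rwa [← huu]
    have hwint : Inr k Δ D (insert w σ) := by
      refine ⟨1, _, by rw [Finset.card_insert_of_notMem hw]; omega, two_pts hL hL', fun h => ?_⟩
      have := two_pts_l (k := k) huu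
      rw [h] at this
      simp at this
    have hn' : ¬ Inr k Δ D (insert u' σ) := fun h =>
      two_int hpure hGP hne hw hu' hwf hwu' hn hwint h
    have hu'f : insert u' σ ∈ Δ.faces := Δ.down_closed hf'.2 (fun x hx => by simp at hx ⊢; tauto)
    obtain ⟨x, hx, hx'⟩ := h1 _ hu'f (Finset.ssubset_insert hu') hn'
    have hF := facet_of_card hpure hf'.2 (by
      rw [Finset.card_union_of_disjoint hf'.1, Finset.card_pair hwu']; omega)
    have := hx' _ hF (fun x hx => by simp at hx ⊢; tauto)
    have hxw : x = w := by
      simp only [Finset.mem_union, Finset.mem_insert, Finset.mem_singleton] at this hx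
      tauto
    subst hxw
    exact hx'

include hpure hGP in
theorem coneL {σ : Finset (Fin n)} (h1 : H1 k Δ D σ) (hC : Cnn Δ σ) {m : ℕ} (hm : σ.card + m = D)
    (hcase : 3 ≤ m ∨ (m = 2 ∧ σ.Nonempty ∧ ¬ Inr k Δ D σ)) {u0 : Fin n} (hu0 : Lk Δ σ {u0})
    (hn0 : ¬ Inr k Δ D (insert u0 σ)) : ∃ w, Cn Δ σ w := by
  obtain ⟨h0, hf0⟩ := Lk_single.1 hu0
  obtain ⟨w, hw, hw'⟩ := h1 _ hf0 (Finset.ssubset_insert h0) hn0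
  rw [Finset.mem_insert, not_or] at hw
  have key : ∀ q, Relation.ReflTransGen (fun a b => Lk Δ σ {a, b}) u0 q →
      Qc Δ σ w q ∧ (q = w → ∀ b, w ≠ b → Lk Δ σ {w, b} → Qc Δ σ w b) := by
    intro q hq
    induction hq with
    | refl => exact ⟨hw', fun h => absurd h.symm hw.1⟩
    | @tail a b _ hab ih =>
      obtain ⟨ha, hb, -, -⟩ := Lk_pair hab
      by_cases hbw : b = w
      · subst hbw
        refine ⟨fun N _ h => h (Finset.mem_insert_self _ _), fun _ c hbc hL => ?_⟩
        by_cases hab' : a = b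
        · exact ih.2 hab' c hbc hL
        · exact h4 hpure hGP h1 hm hcase (Ne.symm hab') hbc (by rw [Finset.pair_comm]; exact hab) hL ih.1
      · refine ⟨?_, fun h => absurd h hbw⟩
        by_cases haw : a = w
        · subst haw
          exact ih.2 rfl b (Ne.symm hbw) hab
        · exact adj hpure hGP h1 hw.2 (Ne.symm haw) ih.1 hb hab
  refine ⟨w, hw.2, fun N hN hs => ?_⟩
  have hNe : ¬ N ⊆ σ := by
    intro h
    have : N = σ := Finset.Subset.antisymm h hs
    subst this
    have := hN.2 _ hf0 (Finset.subset_insert _ _)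
    apply h0
    rw [this]
    exact Finset.mem_insert_self _ _
  rw [Finset.not_subset] at hNe
  obtain ⟨q, hq, hq'⟩ := hNe
  have hqs : insert q σ ⊆ N := Finset.insert_subset hq hs
  exact (key q (hC u0 q hu0 (Lk_single.2 ⟨hq', Δ.down_closed hN.1 hqs⟩))).1 N hN hqs

include hpure hGP in
theorem claim1 : ∀ (m : ℕ) (σ : Finset (Fin n)), σ ∈ Δ.faces → σ.Nonempty → σ.card + m = D → ¬ Inr k Δ D σ →
    ∃ w, Cn Δ σ w := by
  intro m
  induction m using Nat.strong_induction_on with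
  | _ m ih =>
  intro σ hσ hne hm hn
  have h1 : H1 k Δ D σ := by
    intro τ hτ hst hnt
    have := Finset.card_lt_card hst
    have := face_card_le hpure hτ
    exact ih (D - τ.card) (by omega) τ hτ (hne.mono hst.1) (by omega) hnt
  obtain ⟨N, hN, hs⟩ := exists_facet hσ
  obtain ⟨hNL, hNc⟩ := Lk_facet hpure hN hs hm
  by_cases hm0 : m = 0
  · subst hm0
    exfalso
    apply hn
    refine ⟨0, Pi.single ∅ 1, hm, ⟨Sup_single ∅, On_single _ _ (hNL.mono (Finset.empty_subset _)), ?_⟩, ?_⟩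
    · funext S
      rw [Dy_apply]
      refine Finset.sum_eq_zero fun i _ => ?_
      rw [Cv_apply]
      split_ifs
      · simp
      · rw [Pi.single_eq_of_ne (Finset.insert_ne_empty _ _)]; simp
    · intro h
      have := congrFun h ∅
      simp at this
  by_cases hm1 : m = 1
  · subst hm1
    obtain ⟨p, hp⟩ := Finset.card_eq_one.1 hNc
    refine ⟨p, fun h => ?_, fun N' hN' hs' => ?_⟩
    · have : p ∈ N \ σ := by rw [hp]; simp
      exact (Finset.mem_sdiff.1 this).2 h
    · obtain ⟨hNL', hNc'⟩ := Lk_facet hpure hN' hs' hm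
      obtain ⟨r, hr⟩ := Finset.card_eq_one.1 hNc'
      have hrN : r ∈ N' \ σ := by rw [hr]; simp
      by_cases hpr : p = r
      · subst hpr
        exact (Finset.mem_sdiff.1 hrN).1
      · exfalso
        apply hn
        rw [hp] at hNL
        rw [hr] at hNL'
        refine ⟨1, _, hm, two_pts hNL hNL', fun h => ?_⟩
        have := two_pts_l (k := k) hpr
        rw [h] at this
        simp at this
  have hC := cnn_pure hpure hGP hσ hne hm (by omega)
  obtain ⟨p, hp, q, hq, hpq⟩ := Finset.one_lt_card.1 (show 1 < (N \ σ).card by omega)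
  have hpL : Lk Δ σ {p} := hNL.mono (by simpa using hp)
  have hqL : Lk Δ σ {q} := hNL.mono (by simpa using hq)
  have hcase : 3 ≤ m ∨ (m = 2 ∧ σ.Nonempty ∧ ¬ Inr k Δ D σ) := by
    by_cases h : 3 ≤ m
    · exact Or.inl h
    · exact Or.inr ⟨by omega, hne, hn⟩
  by_cases hpi : Inr k Δ D (insert p σ)
  · refine coneL hpure hGP h1 hC hm hcase hqL fun hqi => ?_
    exact two_int hpure hGP hne (Lk_single.1 hpL).1 (Lk_single.1 hqL).1 (Lk_single.1 hpL).2 hpq hn hpi hqi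
  · exact coneL hpure hGP h1 hC hm hcase hpL hpi

include hpure hGP in
theorem cone_main (hC : Cnn Δ ∅) (hD : 3 ≤ D) {σ : Finset (Fin n)} (hσ : σ ∈ Δ.faces) (hne : σ.Nonempty)
    (hn : ¬ Inr k Δ D σ) : ∃ w, Cn Δ ∅ w := by
  obtain ⟨v, hv⟩ := hne
  have hvs : insert v ∅ ⊆ σ := by simpa using hv
  refine coneL hpure hGP ?_ hC (m := D) (by simp) (Or.inl hD) (u0 := v)
    (Lk_single.2 ⟨by simp, Δ.down_closed hσ hvs⟩) fun h => ?_
  · intro τ hτ hst hnt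
    have := face_card_le hpure hτ
    exact claim1 hpure hGP (D - τ.card) τ hτ (Finset.nonempty_iff_ne_empty.2 (by rintro rfl; exact hst.2 le_rfl)) (by omega) hnt
  · exact hn (Inr_up hpure hGP _ rfl (Finset.insert_nonempty _ _) hvs hσ h)

end Cone
end GP


namespace GP

section Hom
variable {k : Type} [Field k] {n : ℕ} (Γ : SC n)

/-- extension by zero -/
noncomputable def xt (c : ℕ) : Γ.relChain k ∅ c →ₗ[k] (Finset (Fin n) → k) := by
  classical
  exact
  { toFun := fun f S => if h : S ∈ Γ.faces ∧ ∅ ⊆ S ∧ S.card = c then f ⟨S, h⟩ else 0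
    map_add' := by
      intro f g; funext S
      rw [Pi.add_apply]
      split_ifs
      · rfl
      · exact (add_zero (0 : k)).symm
    map_smul' := by
      intro r f; funext S
      rw [Pi.smul_apply, RingHom.id_apply]
      split_ifs
      · rfl
      · exact (smul_zero r).symm }

lemma xt_pos {c : ℕ} (f : Γ.relChain k ∅ c) {S : Finset (Fin n)} (h : S ∈ Γ.faces ∧ ∅ ⊆ S ∧ S.card = c) :
    xt Γ c f S = f ⟨S, h⟩ := by
  classical
  exact dif_pos h

lemma xt_neg {c : ℕ} (f : Γ.relChain k ∅ c) {S : Finset (Fin n)} (h : ¬ (S ∈ Γ.faces ∧ S.card = c)) :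
    xt Γ c f S = 0 := by
  classical
  exact dif_neg fun h' => h ⟨h'.1, h'.2.2⟩

lemma xt_val {c : ℕ} (f : Γ.relChain k ∅ c) (τ : Γ.RFace ∅ c) : xt Γ c f τ.1 = f τ := xt_pos Γ f τ.2

lemma xt_Sup {c : ℕ} (f : Γ.relChain k ∅ c) : Sup c (xt Γ c f) := fun S hS => xt_neg Γ f fun h => hS h.2

lemma xt_On {c : ℕ} (f : Γ.relChain k ∅ c) : On (fun S => S ∈ Γ.faces) (xt Γ c f) :=
  fun S hS => xt_neg Γ f fun h => hS h.1

lemma xt_res {c : ℕ} (z : Finset (Fin n) → k) (h : Sup c z) (ho : On (fun S => S ∈ Γ.faces) z) :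
    xt Γ c (fun τ => z τ.1) = z := by
  funext S
  by_cases hS : S ∈ Γ.faces ∧ S.card = c
  · rw [xt_pos Γ _ ⟨hS.1, Finset.empty_subset _, hS.2⟩]
  · rw [xt_neg Γ _ hS]
    by_cases h1 : S ∈ Γ.faces
    · exact (h S fun h2 => hS ⟨h1, h2⟩).symm
    · exact (ho S h1).symm

lemma xt_inj {c : ℕ} {f g : Γ.relChain k ∅ c} (h : xt Γ c f = xt Γ c g) : f = g := by
  funext τ
  rw [← xt_val Γ f, ← xt_val Γ g, h]

lemma xt_sum {c : ℕ} (f : Γ.relChain k ∅ c) (b : Finset (Fin n) → k) :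
    ∑ τ : Γ.RFace ∅ c, b τ.1 * f τ = ∑ S, b S * xt Γ c f S := by
  have hinj : Function.Injective (fun τ : Γ.RFace ∅ c => τ.1) := fun a b h => Subtype.ext h
  have h1 : ∑ τ : Γ.RFace ∅ c, b τ.1 * f τ = ∑ τ : Γ.RFace ∅ c, (fun S => b S * xt Γ c f S) τ.1 := by
    refine Finset.sum_congr rfl fun τ _ => ?_
    simp only [xt_val]
  rw [h1]
  refine Finset.sum_of_injOn (fun τ : Γ.RFace ∅ c => τ.1) hinj.injOn (fun _ _ => by simp) ?_ (fun _ _ => rfl)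
  intro S _ hS
  rw [xt_neg, mul_zero]
  rintro ⟨h, h'⟩
  exact hS ⟨⟨S, h, Finset.empty_subset _, h'⟩, Finset.mem_coe.2 (Finset.mem_univ _), rfl⟩

lemma xt_bd {c : ℕ} (f : Γ.relChain k ∅ (c + 1)) :
    xt Γ c (Γ.relBoundary k ∅ c f) = Dy 1 (xt Γ (c + 1) f) := by
  funext S
  rw [Dy_apply]
  by_cases hS : S ∈ Γ.faces ∧ S.card = c
  · rw [xt_pos Γ _ ⟨hS.1, Finset.empty_subset _, hS.2⟩]
    have h1 := xt_sum Γ f (fun T => ∑ v ∈ T, if v ∉ (∅ : Finset (Fin n)) ∧ T.erase v = S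
      then (-1 : k) ^ ((T.filter (fun w => w < v)).card) else 0)
    refine Eq.trans h1 ?_
    have h2 : ∀ T : Finset (Fin n), (∑ v ∈ T, if v ∉ (∅ : Finset (Fin n)) ∧ T.erase v = S
      then (-1 : k) ^ ((T.filter (fun w => w < v)).card) else 0) * xt Γ (c+1) f T
      = ∑ v, if v ∉ S ∧ T = insert v S then sg k S v * xt Γ (c+1) f (insert v S) else 0 := by
      intro T
      rw [Finset.sum_mul, ← Finset.sum_subset (Finset.subset_univ T)]
      · refine Finset.sum_congr rfl fun v hv => ?_
        by_cases h : T.erase v = S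
        · subst h
          simp only [Finset.notMem_empty, not_false_eq_true, true_and, if_true,
            Finset.notMem_erase, Finset.insert_erase hv, sg_erase_self]
          rfl
        · rw [if_neg (fun h' => h h'.2), if_neg, zero_mul]
          rintro ⟨h3, rfl⟩
          exact h (Finset.erase_insert h3)
      · intro v _ hv
        rw [if_neg]
        rintro ⟨_, rfl⟩
        exact hv (Finset.mem_insert_self _ _)
    rw [Finset.sum_congr rfl fun T _ => h2 T, Finset.sum_comm]
    refine Finset.sum_congr rfl fun v _ => ?_
    rw [Cv_apply]
    by_cases hv : v ∈ S
    · simp [hv]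
    · simp [hv]
  · rw [xt_neg Γ _ hS]
    symm
    refine Finset.sum_eq_zero fun v _ => ?_
    rw [Cv_apply]
    split_ifs with hv
    · simp
    · rw [xt_neg, mul_zero, mul_zero]
      rintro ⟨h1, h2⟩
      rw [Finset.card_insert_of_notMem hv] at h2
      exact hS ⟨Γ.down_closed h1 (Finset.subset_insert _ _), by omega⟩

lemma bd_zero {c : ℕ} (f : Γ.relChain k ∅ (c + 1)) :
    Γ.relBoundary k ∅ c f = 0 ↔ Dy 1 (xt Γ (c + 1) f) = 0 := by
  rw [← xt_bd]
  constructor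
  · intro h; rw [h, map_zero]
  · intro h; exact xt_inj Γ (by rw [h, map_zero])

lemma chain_zero {m c : ℕ} (hle : ∀ F ∈ Γ.faces, F.card ≤ m) (hc : m < c) (f : Γ.relChain k ∅ c) : f = 0 := by
  funext τ
  have := hle _ τ.2.1
  have := τ.2.2.2
  omega

theorem sphere (m : ℕ) (hex : ∃ F ∈ Γ.faces, F.card = m) (hle : ∀ F ∈ Γ.faces, F.card ≤ m)
    (hA : ∀ j, 1 ≤ j → j < m → ∀ z : Finset (Fin n) → k, Sup j z → On (fun S => S ∈ Γ.faces) z → Dy 1 z = 0 →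
      ∃ y, Sup (j + 1) y ∧ On (fun S => S ∈ Γ.faces) y ∧ Dy 1 y = z)
    (z : Finset (Fin n) → k) (hz : Sup m z) (hzo : On (fun S => S ∈ Γ.faces) z) (hz0 : Dy 1 z = 0) (hzne : z ≠ 0)
    (hU : 1 ≤ m → ∀ z' : Finset (Fin n) → k, Sup m z' → On (fun S => S ∈ Γ.faces) z' → Dy 1 z' = 0 →
      ∃ r : k, z' = r • z) : SC.HomologySphereCond k Γ := by
  have hdim : Γ.dim = (m : ℤ) - 1 := by
    unfold SC.dim
    congr 2
    apply le_antisymm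
    · exact Finset.sup_le hle
    · obtain ⟨F, hF, rfl⟩ := hex
      exact Finset.le_sup (f := Finset.card) hF
  refine ⟨fun i => ⟨fun hi => ?_, fun hi => ?_⟩, fun hi => ?_, fun hi => ?_⟩
  · have him : m = i + 1 := by omega
    subst him
    have hbot : Submodule.comap (LinearMap.ker (Γ.relBoundary k ∅ i)).subtype
        (LinearMap.range (Γ.relBoundary k ∅ (i + 1))) = ⊥ := by
      rw [eq_bot_iff]
      rintro ⟨x, hx⟩ ⟨y, hy⟩
      rw [chain_zero Γ hle (by omega) y, map_zero] at hy
      exact Subtype.ext hy.symm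
    let z0 : LinearMap.ker (Γ.relBoundary k ∅ i) := ⟨fun τ => z τ.1, by
      rw [LinearMap.mem_ker, bd_zero, xt_res Γ z hz hzo, hz0]⟩
    have hz0ne : z0 ≠ 0 := by
      intro h
      apply hzne
      rw [← xt_res Γ z hz hzo]
      have : (fun τ : Γ.RFace ∅ (i + 1) => z τ.1) = 0 := congrArg Subtype.val h
      rw [this, map_zero]
    have hfr : Module.finrank k (LinearMap.ker (Γ.relBoundary k ∅ i)) = 1 := by
      refine finrank_eq_one z0 hz0ne ?_
      rintro ⟨x, hx⟩
      obtain ⟨r, hr⟩ := hU (by omega) (xt Γ (i + 1) x) (xt_Sup Γ x) (xt_On Γ x) ((bd_zero Γ x).1 hx)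
      refine ⟨r, Subtype.ext ?_⟩
      refine xt_inj Γ ?_
      rw [hr]
      conv_rhs => rw [← xt_res Γ z hz hzo, ← map_smul]
      rfl
    have e1 := Submodule.quotEquivOfEqBot _ hbot
    have e2 : LinearMap.ker (Γ.relBoundary k ∅ i) ≃ₗ[k] k :=
      LinearEquiv.ofFinrankEq _ _ (by rw [hfr, Module.finrank_self])
    exact ⟨e1.trans e2⟩
  · have him : m ≠ i + 1 := by omega
    refine Submodule.Quotient.subsingleton_iff.2 ?_
    rw [eq_top_iff]
    rintro ⟨x, hx⟩ -
    rcases lt_or_gt_of_ne him with h | h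
    · have hx0 := chain_zero Γ hle h x
      subst hx0
      exact Submodule.zero_mem _
    · obtain ⟨y, hy, hyo, hyz⟩ := hA (i + 1) (by omega) h (xt Γ (i + 1) x) (xt_Sup Γ x) (xt_On Γ x) ((bd_zero Γ x).1 hx)
      refine ⟨fun τ => y τ.1, xt_inj Γ ?_⟩
      rw [xt_bd, xt_res Γ y hy hyo, hyz]
      rfl
  · have hm : m = 0 := by omega
    subst hm
    have hbot : Submodule.comap (⊤ : Submodule k (Γ.relChain k ∅ 0)).subtype
      (LinearMap.range (Γ.relBoundary k ∅ 0)) = ⊥ := by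
      rw [eq_bot_iff]
      rintro ⟨x, hx⟩ ⟨y, hy⟩
      rw [chain_zero Γ hle (by omega) y, map_zero] at hy
      exact Subtype.ext hy.symm
    have : Unique (Γ.RFace ∅ 0) :=
      { default := ⟨∅, Γ.empty_mem, Finset.empty_subset _, rfl⟩
        uniq := fun a => Subtype.ext (Finset.card_eq_zero.1 a.2.2.2) }
    have e1 := Submodule.quotEquivOfEqBot _ hbot
    exact ⟨e1.trans ((Submodule.topEquiv).trans (LinearEquiv.funUnique (Γ.RFace ∅ 0) k k))⟩
  · have hm : 1 ≤ m := by omega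
    refine Submodule.Quotient.subsingleton_iff.2 ?_
    rw [eq_top_iff]
    rintro ⟨x, hx⟩ -
    obtain ⟨F, hF, hFm⟩ := hex
    obtain ⟨v, hv⟩ : F.Nonempty := Finset.card_pos.1 (by omega)
    have hvf : {v} ∈ Γ.faces := Γ.down_closed hF (by simpa using hv)
    refine ⟨(x ⟨∅, Γ.empty_mem, Finset.empty_subset _, rfl⟩) • fun τ => (Pi.single {v} 1 : Finset (Fin n) → k) τ.1,
      xt_inj Γ ?_⟩
    rw [map_smul, map_smul, xt_bd, xt_res Γ _ (Sup_single1 v) (On_single _ _ hvf), Dy_single]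
    funext S
    by_cases hS : S = ∅
    · subst hS
      rw [xt_pos Γ (c := 0) _ ⟨Γ.empty_mem, Finset.empty_subset _, Finset.card_empty⟩, Pi.smul_apply,
        Pi.single_eq_same, smul_eq_mul, mul_one]
      rfl
    · rw [xt_Sup Γ _ S (by simpa using hS)]
      simp [hS]

end Hom

lemma mem_link {n : ℕ} {Δ : SC n} {σ : Finset (Fin n)} (hσ : σ ∈ Δ.faces) (F : Finset (Fin n)) :
    F ∈ (Δ.link σ hσ).faces ↔ Lk Δ σ F := by
  unfold SC.link Lk
  simp only [Finset.mem_filter, Finset.disjoint_iff_inter_eq_empty]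
  constructor
  · rintro ⟨_, h⟩; exact h
  · intro h; exact ⟨Δ.down_closed h.2 Finset.subset_union_left, h⟩

theorem final
    (k : Type) [Field k] {n : ℕ} (Δ : SC n) (d : ℕ) (hd : Δ.dim = (d : ℤ))
    (hconn : Δ.Connected) (hGP : GorensteinPunctured k (srIdeal k Δ)) :
    d ≤ 1 ∨ (∃ v, Δ.IsConePoint v) ∨ Δ.IsHomologyManifold k := by
  by_cases h1 : d ≤ 1
  · exact Or.inl h1
  right
  have hC : Cnn Δ ∅ := by
    have hl : ∀ F, Lk Δ ∅ F ↔ F ∈ Δ.faces := fun F => by simp [Lk]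
    intro p q hp hq
    simp only [hl] at hp hq ⊢
    exact hconn.2 p q hp hq
  have hsup : Δ.faces.sup Finset.card = d + 1 := by
    unfold SC.dim at hd; omega
  obtain ⟨F, hF, hFc⟩ := Finset.exists_mem_eq_sup Δ.faces ⟨_, Δ.empty_mem⟩ Finset.card
  obtain ⟨N0, hN0, hFN⟩ := exists_facet hF
  have hN0c : N0.card = d + 1 := by
    apply le_antisymm
    · rw [← hsup]; exact Finset.le_sup (f := Finset.card) hN0.1
    · rw [← hsup, hFc]; exact Finset.card_le_card hFN
  have hpure : ∀ N, Δ.IsFacet N → N.card = d + 1 := fun N hN => by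
    rw [← hN0c]; exact pure_all hGP hC _ _ hN hN0
  by_cases hall : ∀ σ ∈ Δ.faces, σ.Nonempty → Inr k Δ (d + 1) σ
  · right
    refine ⟨hconn, fun σ hσ hne => ?_⟩
    have hne' := Finset.nonempty_iff_ne_empty.2 hne
    obtain ⟨m, z, hm, ⟨hz, hzo, hz0⟩, hzne⟩ := hall σ hσ hne'
    have hfun : (fun S => S ∈ (Δ.link σ hσ).faces) = Lk Δ σ := funext fun S => propext (mem_link hσ S)
    obtain ⟨T, hT, hTc⟩ := exists_top hpure hσ hm
    have hle : ∀ F, Lk Δ σ F → F.card ≤ m := fun F hF => Lk_card_le hpure hF hm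
    subst hTc
    refine sphere (Δ.link σ hσ) T.card ⟨T, (mem_link hσ T).2 hT, rfl⟩
      (fun F hF => hle F ((mem_link hσ F).1 hF)) ?_ z hz (hfun ▸ hzo) hz0 hzne ?_
    · rw [hfun]
      intro j hj hj' z hz hzo hz0
      exact outA hGP hσ hne' T hT j hj hj' z hz hzo hz0
    · rw [hfun]
      intro hp z' hz' hzo' hz0'
      exact outB0 hGP hσ hne' T hT hp hle z z' hz hzo hz0 hz' hzo' hz0' hzne
  · left
    push Not at hall
    obtain ⟨σ, hσ, hne, hn⟩ := hall
    obtain ⟨w, hw⟩ := cone_main hpure hGP hC (by omega) hσ hne hn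
    have hw' : ∀ N, Δ.IsFacet N → w ∈ N := fun N hN => hw.2 N hN (Finset.empty_subset _)
    exact ⟨w, Δ.down_closed hN0.1 (by simpa using hw' N0 hN0), hw'⟩

end GP

set_option maxHeartbeats 1000000 in
set_option synthInstance.maxHeartbeats 1000000 in
/-- Let `Δ` be a `d`-dimensional connected simplicial complex.  If `k[Δ]` is
Gorenstein on the punctured spectrum, then `d ≤ 1`, or `Δ` has a cone point, or `Δ` is a
`k`-homology manifold. -/
theorem gorensteinPunctured_trichotomy
    (k : Type) [Field k] {n : ℕ} (Δ : SC n) (d : ℕ) (hd : Δ.dim = (d : ℤ))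
    (hconn : Δ.Connected) (hGP : GorensteinPunctured k (srIdeal k Δ)) :
    d ≤ 1 ∨ (∃ v, Δ.IsConePoint v) ∨ Δ.IsHomologyManifold k := by
  exact GP.final k Δ d hd hconn hGP
end

section
/- Let Δ be a d-dimensional normal pseudomanifold and 𝕜 a field. Then for every face σ ∈ Δ, the relative simplicial homology H_d(Δ, cost_Δ(σ); 𝕜) has 𝕜-dimension at most 1. -/
/-! # Preliminaries

Self-contained definitions: simplicial complexes, simplicial homology, Stanley–Reisner rings,
canonical modules, canonical traces, and the various Gorenstein-type conditions. -/

open CategoryTheory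

/-- Every face has at most `d + 1` elements. -/
theorem SC.card_le_of_dim {n : ℕ} (Δ : SC n) (d : ℕ) (hd : Δ.dim = (d : ℤ))
    {τ : Finset (Fin n)} (hτ : τ ∈ Δ.faces) : τ.card ≤ d + 1 := by
  have h1 : τ.card ≤ Δ.faces.sup Finset.card := Finset.le_sup (f := Finset.card) hτ
  unfold SC.dim at hd
  omega

/-- Every face lies in a facet. -/
theorem SC.exists_facet {n : ℕ} (Δ : SC n) {τ : Finset (Fin n)} (hτ : τ ∈ Δ.faces) :
    ∃ F, Δ.IsFacet F ∧ τ ⊆ F := by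
  obtain ⟨F, hF1, hF2⟩ := Δ.faces.exists_le_maximal hτ
  exact ⟨F, ⟨hF2.prop, fun G hG hFG => hF2.eq_of_le hG hFG⟩, hF1⟩

/-- A face with `d + 1` elements is a facet. -/
theorem SC.isFacet_of_card {n : ℕ} (Δ : SC n) (d : ℕ) (hd : Δ.dim = (d : ℤ))
    {F : Finset (Fin n)} (hF : F ∈ Δ.faces) (hc : F.card = d + 1) : Δ.IsFacet F := by
  refine ⟨hF, fun G hG hFG => Finset.eq_of_subset_of_card_le hFG ?_⟩
  have := Δ.card_le_of_dim d hd hG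
  omega

/-- Strongly connected complexes are pure. -/
theorem SC.facet_card {n : ℕ} (Δ : SC n) (d : ℕ) (hd : Δ.dim = (d : ℤ))
    (hsc : Δ.StronglyConnected) {F : Finset (Fin n)} (hF : Δ.IsFacet F) : F.card = d + 1 := by
  by_contra hne
  have hle := Δ.card_le_of_dim d hd hF.1
  obtain ⟨T, hT, hTc⟩ := Finset.exists_mem_eq_sup Δ.faces ⟨∅, Δ.empty_mem⟩ Finset.card
  have hTc' : T.card = d + 1 := by
    unfold SC.dim at hd
    omega
  have key : ∀ G, Relation.ReflTransGen
      (fun α β => Δ.IsFacet α ∧ Δ.IsFacet β ∧ ((α ∩ β).card : ℤ) - 1 = Δ.dim - 1) F G →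
      G = F := by
    intro G h
    induction h with
    | refl => rfl
    | tail _ hstep ih =>
      rw [ih] at hstep
      obtain ⟨_, hb, hc⟩ := hstep
      rename_i c _ _
      have hbc : F ∩ c = F := by
        apply Finset.eq_of_subset_of_card_le Finset.inter_subset_left
        omega
      exact (hF.2 _ hb.1 (Finset.inter_eq_left.mp hbc)).symm
  have := key T (hsc F T hF (Δ.isFacet_of_card d hd hT hTc'))
  subst this
  exact hne hTc'

/-- In a normal pseudomanifold, facets containing a given face are strongly connected among
themselves, phrased as propagation of a predicate. -/
theorem SC.propagate {n : ℕ} (Δ : SC n) (d : ℕ) (hd : Δ.dim = (d : ℤ))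
    (hpm : Δ.IsPseudomanifold) (hnorm : Δ.Normal) (σ₀ : Finset (Fin n))
    (P : Finset (Fin n) → Prop)
    (hP : ∀ F G, Δ.IsFacet F → Δ.IsFacet G → σ₀ ⊆ F ∩ G → (F ∩ G).card = d → P F → P G)
    (m : ℕ) : ∀ σ ∈ Δ.faces, σ₀ ⊆ σ → d + 1 ≤ σ.card + m →
      ∀ F G, Δ.IsFacet F → Δ.IsFacet G → σ ⊆ F → σ ⊆ G → P F → P G := by
  induction m with
  | zero =>
    intro σ hσ h0 hm F G hF hG hσF hσG hPF
    have e1 := Finset.eq_of_subset_of_card_le hσF (by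
      have := Δ.card_le_of_dim d hd hF.1; omega)
    have e2 := Finset.eq_of_subset_of_card_le hσG (by
      have := Δ.card_le_of_dim d hd hG.1; omega)
    rw [← e2, e1]; exact hPF
  | succ m ih =>
    intro σ hσ h0 hm F G hF hG hσF hσG hPF
    have cF := Δ.facet_card d hd hpm.1 hF
    have cG := Δ.facet_card d hd hpm.1 hG
    by_cases hge : d + 1 ≤ σ.card + m
    · exact ih σ hσ h0 hge F G hF hG hσF hσG hPF
    by_cases hFG : F = G
    · exact hFG ▸ hPF
    by_cases hcd : d ≤ σ.card
    · refine hP F G hF hG (h0.trans (Finset.subset_inter hσF hσG)) ?_ hPF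
      have h1 : σ.card ≤ (F ∩ G).card := Finset.card_le_card (Finset.subset_inter hσF hσG)
      have h2 : (F ∩ G).card ≤ F.card := Finset.card_le_card Finset.inter_subset_left
      have h3 : (F ∩ G).card ≠ F.card := by
        intro h
        have := Finset.eq_of_subset_of_card_le (Finset.inter_subset_left (s₁ := F) (s₂ := G))
          h.ge
        exact hFG (hF.2 G hG.1 (Finset.inter_eq_left.mp this))
      omega
    have hconn := hnorm σ hσ (by omega)
    have mem_link : ∀ τ, τ ∈ (Δ.link σ hσ).faces ↔ τ ∈ Δ.faces ∧ τ ∩ σ = ∅ ∧ τ ∪ σ ∈ Δ.faces :=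
      fun τ => by simp [SC.link]
    have vert : ∀ H, Δ.IsFacet H → σ ⊆ H → ∃ u ∈ H, u ∉ σ ∧ (Δ.link σ hσ).IsVertex u := by
      intro H hH hσH
      have cH := Δ.facet_card d hd hpm.1 hH
      obtain ⟨u, huH, hu⟩ := Finset.exists_mem_notMem_of_card_lt_card
        (show σ.card < H.card by omega)
      refine ⟨u, huH, hu, (mem_link _).2 ⟨Δ.down_closed hH.1 (by simpa using huH), ?_, ?_⟩⟩
      · exact Finset.singleton_inter_of_notMem hu
      · exact Δ.down_closed hH.1 (Finset.union_subset (by simpa using huH) hσH)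
    obtain ⟨u, huF, huσ, hul⟩ := vert F hF hσF
    obtain ⟨v, hvG, hvσ, hvl⟩ := vert G hG hσG
    have step : ∀ w, w ∉ σ → insert w σ ∈ Δ.faces → ∀ F' G', Δ.IsFacet F' → Δ.IsFacet G' →
        insert w σ ⊆ F' → insert w σ ⊆ G' → P F' → P G' := by
      intro w hw hwf
      refine ih (insert w σ) hwf (h0.trans (Finset.subset_insert _ _)) ?_
      rw [Finset.card_insert_of_notMem hw]; omega
    have ins : ∀ w H, Δ.IsFacet H → w ∈ H → σ ⊆ H → insert w σ ∈ Δ.faces ∧ insert w σ ⊆ H := by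
      intro w H hH hwH hσH
      have : insert w σ ⊆ H := Finset.insert_subset hwH hσH
      exact ⟨Δ.down_closed hH.1 this, this⟩
    have key : ∀ w, Relation.ReflTransGen
        (fun a b => ({a, b} : Finset (Fin n)) ∈ (Δ.link σ hσ).faces) u w →
        w ∉ σ ∧ ∀ H, Δ.IsFacet H → σ ⊆ H → w ∈ H → P H := by
      intro w hw
      induction hw with
      | refl =>
        refine ⟨huσ, fun H hH hσH huH => ?_⟩
        exact step u huσ (ins u F hF huF hσF).1 F H hF hH (ins u F hF huF hσF).2
          (ins u H hH huH hσH).2 hPF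
      | tail _ hab ih2 =>
        rename_i a b _
        obtain ⟨haσ, hall⟩ := ih2
        obtain ⟨_, hdisj, hun⟩ := (mem_link _).1 hab
        have hbσ : b ∉ σ := by
          intro hb
          have : b ∈ ({a, b} : Finset (Fin n)) ∩ σ := by simp [hb]
          rw [hdisj] at this
          simp at this
        obtain ⟨K, hK, hKsub⟩ := Δ.exists_facet hun
        have hσK : σ ⊆ K := Finset.subset_union_right.trans hKsub
        have haK : a ∈ K := hKsub (by simp)
        have hbK : b ∈ K := hKsub (by simp)
        refine ⟨hbσ, fun H hH hσH hbH => ?_⟩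
        exact step b hbσ (ins b K hK hbK hσK).1 K H hK hH (ins b K hK hbK hσK).2
          (ins b H hH hbH hσH).2 (hall K hK hσK haK)
    exact (key v (hconn.2 u v hul hvl)).2 G hG hσG hvG

/-- A relative top cycle vanishing on a facet vanishes on every adjacent facet. -/
theorem SC.cycle_adjacent (k : Type) [Field k] {n : ℕ} (Δ : SC n) (d : ℕ)
    (hd : Δ.dim = (d : ℤ)) (hpm : Δ.IsPseudomanifold) (σ : Finset (Fin n))
    (z : Δ.relChain k σ (d + 1)) (hz : Δ.relBoundary k σ d z = 0)
    (F G : Δ.RFace σ (d + 1)) (hFG : (F.1 ∩ G.1).card = d) (hF : z F = 0) : z G = 0 := by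
  have hρf : F.1 ∩ G.1 ∈ Δ.faces := Δ.down_closed F.2.1 Finset.inter_subset_left
  let ρ : Δ.RFace σ d := ⟨F.1 ∩ G.1, hρf, Finset.subset_inter F.2.2.1 G.2.2.1, hFG⟩
  have h0 := congrFun hz ρ
  have hsum : ∑ τ, Δ.relBMat k σ d ρ τ * z τ = 0 := by
    simpa [SC.relBoundary, Matrix.mulVec, dotProduct] using h0
  have hne : F.1 ≠ G.1 := by
    intro h
    have := F.2.2.2
    rw [h, Finset.inter_self, ← h] at hFG
    omega
  have h2 := hpm.2 _ hρf (by omega)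
  have hset : ({F.1, G.1} : Set (Finset (Fin n))) =
      {τ : Finset (Fin n) | Δ.IsFacet τ ∧ F.1 ∩ G.1 ⊆ τ} := by
    apply Set.eq_of_subset_of_ncard_le
    · rintro τ (rfl | rfl)
      · exact ⟨Δ.isFacet_of_card d hd F.2.1 F.2.2.2, Finset.inter_subset_left⟩
      · exact ⟨Δ.isFacet_of_card d hd G.2.1 G.2.2.2, Finset.inter_subset_right⟩
    · rw [h2, Set.ncard_pair hne]
    · exact Set.toFinite _
  rw [Finset.sum_eq_single G] at hsum
  · rcases mul_eq_zero.mp hsum with h | h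
    · exfalso
      obtain ⟨v, hv⟩ : ∃ v, G.1 \ (F.1 ∩ G.1) = {v} := by
        apply Finset.card_eq_one.mp
        rw [Finset.card_sdiff_of_subset Finset.inter_subset_right, G.2.2.2, hFG]
        omega
      have hvm : v ∈ G.1 ∧ v ∉ F.1 ∩ G.1 := by
        rw [← Finset.mem_sdiff, hv]; simp
      have herase : G.1.erase v = F.1 ∩ G.1 := by
        rw [← Finset.sdiff_singleton_eq_erase, ← hv]
        exact Finset.sdiff_sdiff_eq_self Finset.inter_subset_right
      unfold SC.relBMat at h
      rw [Finset.sum_eq_single v] at h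
      · rw [if_pos ⟨fun hvσ => hvm.2 (ρ.2.2.1 hvσ), herase⟩] at h
        exact pow_ne_zero _ (neg_ne_zero.mpr one_ne_zero) h
      · intro w hw hwv
        rw [if_neg]
        rintro ⟨_, hw2⟩
        have : w ∈ G.1.erase v := Finset.mem_erase.mpr ⟨hwv, hw⟩
        rw [herase] at this
        have h3 : w ∈ G.1.erase w := by rw [hw2]; exact this
        simp at h3
      · intro hv'
        exact absurd hvm.1 hv'
    · exact h
  · intro τ _ hτ
    by_cases hsub : F.1 ∩ G.1 ⊆ τ.1
    · have : τ.1 ∈ ({F.1, G.1} : Set (Finset (Fin n))) := by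
        rw [hset]
        exact ⟨Δ.isFacet_of_card d hd τ.2.1 τ.2.2.2, hsub⟩
      rcases this with h | h
      · rw [show τ = F from Subtype.ext h, hF, mul_zero]
      · exact absurd (Subtype.ext h) hτ
    · have : Δ.relBMat k σ d ρ τ = 0 := by
        unfold SC.relBMat
        apply Finset.sum_eq_zero
        intro v _
        rw [if_neg]
        rintro ⟨_, h⟩
        apply hsub
        change τ.1.erase v = F.1 ∩ G.1 at h
        rw [← h]
        exact Finset.erase_subset _ _
      rw [this, zero_mul]
  · intro h
    exact absurd (Finset.mem_univ _) h

set_option maxHeartbeats 1000000 in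
set_option synthInstance.maxHeartbeats 1000000 in
/-- Let `Δ` be a `d`-dimensional normal pseudomanifold and `k` a field.
For every face `σ` of `Δ`, the relative homology `H_d(Δ, cost_Δ σ; k)` has `k`-dimension at
most `1`. -/
theorem relHomology_rank_le_one
    (k : Type) [Field k] {n : ℕ} (Δ : SC n) (d : ℕ) (hd : Δ.dim = (d : ℤ))
    (hpm : Δ.IsPseudomanifold) (hnorm : Δ.Normal)
    (σ : Finset (Fin n)) (hσ : σ ∈ Δ.faces) :
    Module.rank k (Δ.relHomology k σ d) ≤ 1 := by
  obtain ⟨F₀, hF₀, hσF₀⟩ := Δ.exists_facet hσ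
  let f₀ : Δ.RFace σ (d + 1) := ⟨F₀, hF₀.1, hσF₀, Δ.facet_card d hd hpm.1 hF₀⟩
  let ev : LinearMap.ker (Δ.relBoundary k σ d) →ₗ[k] k :=
    (LinearMap.proj f₀).comp (LinearMap.ker (Δ.relBoundary k σ d)).subtype
  have hinj : Function.Injective ev := by
    rw [injective_iff_map_eq_zero]
    rintro ⟨z, hz⟩ hev
    have hz0 : z f₀ = 0 := hev
    have hz' : Δ.relBoundary k σ d z = 0 := hz
    apply Subtype.ext
    funext G
    refine SC.propagate Δ d hd hpm hnorm σ
      (fun F => ∀ h : F ∈ Δ.faces ∧ σ ⊆ F ∧ F.card = d + 1, z ⟨F, h⟩ = 0) ?_ (d + 1) σ hσ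
      (Finset.Subset.refl _) (by omega) F₀ G.1 hF₀ (Δ.isFacet_of_card d hd G.2.1 G.2.2.2)
      hσF₀ G.2.2.1 (fun _ => hz0) G.2
    intro F G hF hG hs hc hPF hG'
    have hF' : F ∈ Δ.faces ∧ σ ⊆ F ∧ F.card = d + 1 :=
      ⟨hF.1, hs.trans Finset.inter_subset_left, Δ.facet_card d hd hpm.1 hF⟩
    exact Δ.cycle_adjacent k d hd hpm σ z hz' ⟨F, hF'⟩ ⟨G, hG'⟩ hc (hPF hF')
  have h1 : Module.rank k (LinearMap.ker (Δ.relBoundary k σ d)) ≤ 1 := by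
    have := LinearMap.rank_le_of_injective ev hinj
    rwa [Module.rank_self] at this
  exact (rank_quotient_le _).trans h1
end
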